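/- arXiv:0801.1744 — 2 statements merged into one kernel-verified Lean document; each statement's English description precedes it below -/
import Mathlib

section
/- Let G be a connected simple graph on n vertices with m edges such that m ≤ 2n − 1 and the maximum degree of G satisfies Δ(G) ≤ 4. Then the acyclic chromatic index of G satisfies a'(G) ≤ 6, i.e., G has an acyclic proper edge coloring using at most 6 colors. -/
/-- A proper edge coloring: distinct edges of `G` sharing a vertex get distinct colors. -/
def ProperEdgeColoring {V : Type*} (G : SimpleGraph V) (c : Sym2 V → ℕ) : Prop :=
  ∀ e₁ ∈ G.edgeSet, ∀ e₂ ∈ G.edgeSet, e₁ ≠ e₂ → (∃ v : V, v ∈ e₁ ∧ v ∈ e₂) → c e₁ ≠ c e₂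

/-- An acyclic proper edge coloring: proper, and no cycle of `G` uses only two colors. -/
def AcyclicProperEdgeColoring {V : Type*} (G : SimpleGraph V) (c : Sym2 V → ℕ) : Prop :=
  ProperEdgeColoring G c ∧
    ∀ (v : V) (p : G.Walk v v), p.IsCycle →
      ¬ ∃ α β : ℕ, ∀ e ∈ p.edges, c e = α ∨ c e = β

/-- The set of colors appearing on edges of `G` incident to `u`. -/
def incidentColors {V : Type*} (G : SimpleGraph V) (c : Sym2 V → ℕ) (u : V) : Set ℕ :=
  {γ : ℕ | ∃ v : V, G.Adj u v ∧ c s(u, v) = γ}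

/-- An (α,β)-bichromatic path: a path all of whose edges are colored α or β. -/
def IsBichromaticPath {V : Type*} (G : SimpleGraph V) (c : Sym2 V → ℕ) (α β : ℕ)
    {a b : V} (p : G.Walk a b) : Prop :=
  p.IsPath ∧ ∀ e ∈ p.edges, c e = α ∨ c e = β

/-- A maximal (α,β)-bichromatic path: it cannot be extended at either endpoint. -/
def IsMaximalBichromaticPath {V : Type*} (G : SimpleGraph V) (c : Sym2 V → ℕ) (α β : ℕ)
    {a b : V} (p : G.Walk a b) : Prop :=
  IsBichromaticPath G c α β p ∧
    (∀ w : V, G.Adj a w → (c s(a, w) = α ∨ c s(a, w) = β) → s(a, w) ∈ p.edges) ∧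
    (∀ w : V, G.Adj b w → (c s(b, w) = α ∨ c s(b, w) = β) → s(b, w) ∈ p.edges)

/-- An (α,β,ab)-critical path: a maximal (α,β)-bichromatic path from `a` to `b`
whose edges incident to the endpoints are colored α. -/
def IsCriticalPath {V : Type*} (G : SimpleGraph V) (c : Sym2 V → ℕ) (α β : ℕ)
    {a b : V} (p : G.Walk a b) : Prop :=
  IsMaximalBichromaticPath G c α β p ∧
    (∀ e ∈ p.edges, a ∈ e → c e = α) ∧ (∀ e ∈ p.edges, b ∈ e → c e = α)


theorem exists_mem_notin_two {S : Finset (Fin 6)} (hS : 3 ≤ S.card) (a b : Fin 6) :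
    ∃ x ∈ S, x ≠ a ∧ x ≠ b := by
  have h : ({a, b} : Finset (Fin 6)).card < S.card :=
    lt_of_le_of_lt Finset.card_le_two (by omega)
  obtain ⟨x, hx, hx'⟩ := Finset.exists_mem_notMem_of_card_lt_card h
  simp only [Finset.mem_insert, Finset.mem_singleton, not_or] at hx'
  exact ⟨x, hx, hx'⟩

theorem card_compl_six {S : Finset (Fin 6)} (hS : S.card ≤ 3) : 3 ≤ Sᶜ.card := by
  have := Finset.card_compl_add_card S
  simp only [Fintype.card_fin] at this
  omega

theorem exists_notin_two {S : Finset (Fin 6)} (hS : S.card ≤ 3) (a b : Fin 6) :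
    ∃ x, x ∉ S ∧ x ≠ a ∧ x ≠ b := by
  obtain ⟨x, hx, h⟩ := exists_mem_notin_two (card_compl_six hS) a b
  exact ⟨x, Finset.mem_compl.1 hx, h⟩

theorem exists_common_free {A B : Finset (Fin 6)} (hA : A.card ≤ 3) (hB : B.card ≤ 3)
    (h : A ≠ Bᶜ) : ∃ x, x ∉ A ∧ x ∉ B := by
  by_contra! hc
  apply h
  symm
  apply Finset.eq_of_subset_of_card_le
  · intro x hx
    by_contra hxA
    exact Finset.mem_compl.1 hx (hc x hxA)
  · have := card_compl_six hB
    omega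

/-- If no two palettes are complementary, harmless colors exist. -/
theorem harmless_exists (A B C : Finset (Fin 6)) (hA : A.card ≤ 3) (hB : B.card ≤ 3)
    (hC : C.card ≤ 3) (hAB : A ≠ Bᶜ) (hAC : A ≠ Cᶜ) (hBC : B ≠ Cᶜ) :
    ∃ p q r, p ∉ A ∧ q ∉ B ∧ r ∉ C ∧ p ≠ q ∧ p ≠ r ∧ q ≠ r ∧
      ¬ (p ∈ B ∧ q ∈ A) ∧ ¬ (p ∈ C ∧ r ∈ A) ∧ ¬ (q ∈ C ∧ r ∈ B) := by
  obtain ⟨x, hx⟩ := exists_common_free hA hB hAB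
  obtain ⟨y, hy⟩ := exists_common_free hB hC hBC
  obtain ⟨z, hz⟩ := exists_common_free hA hC hAC
  by_cases h0 : ∃ t, t ∉ A ∧ t ∉ B ∧ t ∉ C
  · obtain ⟨t, htA, htB, htC⟩ := h0
    by_cases hX : ∃ d, d ≠ t ∧ d ∉ A ∧ d ∉ B
    · obtain ⟨d, hd, hdA, hdB⟩ := hX
      obtain ⟨e, he, h1, h2⟩ := exists_notin_two hB t d
      exact ⟨d, e, t, by grind⟩
    by_cases hY : ∃ d, d ≠ t ∧ d ∉ B ∧ d ∉ C
    · obtain ⟨d, hd, hdA, hdB⟩ := hY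
      obtain ⟨e, he, h1, h2⟩ := exists_notin_two hC t d
      exact ⟨t, d, e, by grind⟩
    by_cases hZ : ∃ d, d ≠ t ∧ d ∉ A ∧ d ∉ C
    · obtain ⟨d, hd, hdA, hdB⟩ := hZ
      obtain ⟨e, he, h1, h2⟩ := exists_notin_two hC t d
      exact ⟨d, t, e, by grind⟩
    exfalso
    have cA := card_compl_six hA
    have cB := card_compl_six hB
    have cC := card_compl_six hC
    have eA := Finset.card_erase_of_mem (Finset.mem_compl.2 htA)
    have eB := Finset.card_erase_of_mem (Finset.mem_compl.2 htB)
    have eC := Finset.card_erase_of_mem (Finset.mem_compl.2 htC)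
    have d1 : Disjoint (Aᶜ.erase t) (Bᶜ.erase t) := by
      rw [Finset.disjoint_left]; intro u; simp only [Finset.mem_erase, Finset.mem_compl]; grind
    have d2 : Disjoint (Aᶜ.erase t ∪ Bᶜ.erase t) (Cᶜ.erase t) := by
      rw [Finset.disjoint_left]; intro u
      simp only [Finset.mem_union, Finset.mem_erase, Finset.mem_compl]; grind
    have c1 := Finset.card_union_of_disjoint d1
    have c2 := Finset.card_union_of_disjoint d2
    have c3 : (Aᶜ.erase t ∪ Bᶜ.erase t ∪ Cᶜ.erase t).card ≤ (Finset.univ.erase t).card := by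
      apply Finset.card_le_card; intro u
      simp only [Finset.mem_union, Finset.mem_erase, Finset.mem_compl, Finset.mem_univ]; grind
    rw [Finset.card_erase_of_mem (Finset.mem_univ t)] at c3
    simp only [Finset.card_univ, Fintype.card_fin] at c3
    omega
  · push Not at h0
    exact ⟨x, y, z, by grind⟩

/-- The abstract situation of a coloring that does not extend. -/
structure Stuck (P : Fin 3 → Finset (Fin 6)) (R : Fin 3 → Fin 3 → Fin 6 → Fin 6 → Prop) : Prop where
  symm : ∀ i j p q, R i j p q → R j i q p
  swap : ∀ i j p q, R i j p q → R i j q p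
  mem : ∀ i j p q, i ≠ j → R i j p q → p ∉ P i → q ∈ P i
  uniq : ∀ i j k p q, i ≠ j → i ≠ k → j ≠ k → R i j p q → R i k p q →
    (p ∉ P i ∨ q ∉ P i) → (p ∉ P j ∨ q ∉ P j) → (p ∉ P k ∨ q ∉ P k) → False
  no : ∀ f : Fin 3 → Fin 6, Function.Injective f → (∀ i, f i ∉ P i) →
    ∃ i j, i ≠ j ∧ R i j (f i) (f j)

theorem Stuck.no3 {P R} (h : Stuck P R) {a b c : Fin 3} (hab : a ≠ b) (hac : a ≠ c) (hbc : b ≠ c)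
    {p q r : Fin 6} (hp : p ∉ P a) (hq : q ∉ P b) (hr : r ∉ P c) (hpq : p ≠ q) (hpr : p ≠ r)
    (hqr : q ≠ r) : R a b p q ∨ R a c p r ∨ R b c q r := by
  have tri : ∀ i : Fin 3, i = a ∨ i = b ∨ i = c := by omega
  obtain ⟨i, j, hij, hR⟩ := h.no (fun i => if i = a then p else if i = b then q else r)
    (by
      intro i j hij
      rcases tri i with rfl | rfl | rfl <;> rcases tri j with rfl | rfl | rfl <;>
        simp_all [eq_comm])
    (by
      intro i
      rcases tri i with rfl | rfl | rfl <;> simp_all [eq_comm])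
  have := h.symm
  rcases tri i with rfl | rfl | rfl <;> rcases tri j with rfl | rfl | rfl <;>
    simp_all [eq_comm]

theorem Stuck.core {P R} (h : Stuck P R) (hcard : ∀ i, (P i).card ≤ 3) {a b c : Fin 3}
    (hab : a ≠ b) (hac : a ≠ c) (hbc : b ≠ c) (hB : P b = (P c)ᶜ) (hA : P a ≠ P c) :
    ∀ r, r ∉ P c → ∃ z, z ≠ c ∧ Disjoint (P z) (P c) ∧ ∀ q ∈ P c, R c z r q := by
  have memB : ∀ q, q ∈ P b ↔ q ∉ P c := by intro q; rw [hB, Finset.mem_compl]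
  have hdis : Disjoint (P b) (P c) := by
    rw [Finset.disjoint_left]; intro q; simp [memB]
  have cardc : 3 ≤ (P c).card := by
    have := card_compl_six (hcard b)
    rwa [hB, compl_compl] at this
  have cardb : 3 ≤ (P b).card := by
    have := card_compl_six (hcard c)
    rwa [hB]
  intro r hr
  by_cases hAB : P a = P b
  · -- all go to `a` or all go to `b`
    have hdisa : Disjoint (P a) (P c) := by rw [hAB]; exact hdis
    have key : ∀ p ∈ P c, ∀ q ∈ P c, p ≠ q → R c a r p ∨ R c b r q := by
      intro p hp q hq hpq
      have h1 : p ∉ P b := by rw [memB]; simpa using hp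
      have h2 : q ∉ P b := by rw [memB]; simpa using hq
      rcases h.no3 hab hac hbc (hAB ▸ h1) h2 hr hpq (by grind) (by grind) with h' | h' | h'
      · exact absurd (hAB ▸ h.mem _ _ _ _ hab h' (hAB ▸ h1)) h2
      · exact Or.inl (h.symm _ _ _ _ h')
      · exact Or.inr (h.symm _ _ _ _ h')
    have nb : ∀ p ∈ P c, R c a r p → R c b r p → False := by
      intro p hp h1 h2
      have h3 : p ∉ P b := by rw [memB]; simpa using hp
      exact h.uniq _ _ _ _ _ hac.symm hbc.symm hab h1 h2 (Or.inl hr) (Or.inr (hAB ▸ h3)) (Or.inr h3)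
    by_cases hall : ∀ q ∈ P c, R c b r q
    · exact ⟨b, hbc, hdis, hall⟩
    · push Not at hall
      obtain ⟨q0, hq0, hq0'⟩ := hall
      have h1 : ∀ p ∈ P c, p ≠ q0 → R c a r p := by
        intro p hp hpq
        rcases key p hp q0 hq0 hpq with h' | h'
        · exact h'
        · exact absurd h' hq0'
      refine ⟨a, hac, hdisa, fun q hq => ?_⟩
      by_cases hqq : q = q0
      · subst hqq
        obtain ⟨p, hp, hpq, -⟩ := exists_mem_notin_two cardc q q
        rcases key q hq p hp hpq.symm with h' | h'
        · exact h'
        · exact (nb p hp (h1 p hp hpq) h').elim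
      · exact h1 q hq hqq
  · refine ⟨b, hbc, hdis, ?_⟩
    have key : ∀ p q r, p ∉ P a → q ∈ P c → r ∉ P c → p ≠ q → p ≠ r →
        R a b p q ∨ R a c p r ∨ R b c q r := by
      intro p q r hp hq hr hpq hpr
      exact h.no3 hab hac hbc hp (by rw [memB]; simpa using hq) hr hpq hpr (by grind)
    have m1 : ∀ p q, R a b p q → p ∉ P a → q ∉ P b → q ∈ P a ∧ p ∈ P b := by
      intro p q h1 h2 h3
      exact ⟨h.mem _ _ _ _ hab h1 h2, h.mem _ _ _ _ hab.symm (h.symm _ _ _ _ h1) h3⟩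
    have m2 : ∀ p r, R a c p r → p ∉ P a → r ∉ P c → r ∈ P a ∧ p ∈ P c := by
      intro p q h1 h2 h3
      exact ⟨h.mem _ _ _ _ hac h1 h2, h.mem _ _ _ _ hac.symm (h.symm _ _ _ _ h1) h3⟩
    have er : ∃ r0, r0 ∉ P c ∧ r0 ∉ P a := by
      by_contra! hcon
      apply hAB
      symm
      apply Finset.eq_of_subset_of_card_le
      · intro x hx; exact hcon x ((memB x).1 hx)
      · exact (hcard a).trans cardb
    have eq : ∃ q0, q0 ∈ P c ∧ q0 ∉ P a := by
      by_contra! hcon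
      apply hA
      symm
      apply Finset.eq_of_subset_of_card_le
      · intro x hx; exact hcon x hx
      · exact (hcard a).trans cardc
    obtain ⟨r0, hr0, hr0'⟩ := er
    obtain ⟨q0, hq0, hq0'⟩ := eq
    have s1 : ∀ q ∈ P c, q ∉ P a → R b c q r := by
      intro q hq hqa
      by_cases hra : r ∈ P a
      · have := key r0 q r hr0' hq hr (by grind) (by grind)
        have := m1 r0 q; have := m2 r0 r; grind
      · obtain ⟨p, hp, hpq, hpr⟩ := exists_notin_two (hcard a) q r
        have := key p q r hp hq hr hpq hpr
        have := m1 p q; have := m2 p r; grind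
    intro q hq
    apply h.symm
    by_cases hqa : q ∈ P a
    · have k1 := key q0 q r hq0' hq hr (by grind) (by grind)
      have k2 := m1 q0 q
      have k3 := m2 q0 r
      have k4 : R a c q0 r → False := by
        intro h5
        exact h.uniq c a b q0 r hac.symm hbc.symm hab (h.swap _ _ _ _ (h.symm _ _ _ _ h5))
          (h.swap _ _ _ _ (h.symm _ _ _ _ (s1 q0 hq0 hq0'))) (Or.inr hr) (Or.inl hq0')
          (Or.inl (by rw [memB]; simpa using hq0))
      grind
    · exact s1 q hq hqa

/-- The pivot depends on the palettes only. -/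
theorem exists_pivot (P : Fin 3 → Finset (Fin 6)) (hcard : ∀ i, (P i).card ≤ 3) :
    ∃ k, ∀ R, Stuck P R → (P k).card = 3 ∧ ∀ r, r ∉ P k → ∃ z, z ≠ k ∧ Disjoint (P z) (P k) ∧
      ∀ q ∈ P k, R k z r q := by
  by_cases hc : ∃ b c, b ≠ c ∧ P b = (P c)ᶜ
  · have hc' : ∃ a b c : Fin 3, a ≠ b ∧ a ≠ c ∧ b ≠ c ∧ P b = (P c)ᶜ ∧ P a ≠ P c := by
      obtain ⟨b, c, hbc, h⟩ := hc
      obtain ⟨a, hab, hac⟩ : ∃ a : Fin 3, a ≠ b ∧ a ≠ c :=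
        (by decide : ∀ b c : Fin 3, ∃ a : Fin 3, a ≠ b ∧ a ≠ c) b c
      by_cases hac' : P a = P c
      · refine ⟨a, c, b, hac, hab, hbc.symm, by rw [h, compl_compl], ?_⟩
        rw [hac', h]
        intro h'
        have h1 := Finset.card_compl_add_card (P c)
        rw [← h'] at h1
        have h2 : (0 : Fin 6) ∈ P c ↔ (0 : Fin 6) ∈ (P c)ᶜ := by rw [← h']
        rw [Finset.mem_compl] at h2
        tauto
      · exact ⟨a, b, c, hab, hac, hbc, h, hac'⟩
    obtain ⟨a, b, c, hab, hac, hbc, hB, hA⟩ := hc'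
    refine ⟨c, fun R h => ⟨?_, h.core hcard hab hac hbc hB hA⟩⟩
    have := card_compl_six (hcard b)
    rw [hB, compl_compl] at this
    exact le_antisymm (hcard c) this
  · push Not at hc
    refine ⟨0, fun R h => ?_⟩
    exfalso
    obtain ⟨p, q, r, hp, hq, hr, hpq, hpr, hqr, h1, h2, h3⟩ :=
      harmless_exists (P 0) (P 1) (P 2) (hcard _) (hcard _) (hcard _)
        (hc _ _ (by decide)) (hc _ _ (by decide)) (hc _ _ (by decide))
    have m : ∀ i j p q, i ≠ j → R i j p q → p ∉ P i → q ∉ P j → p ∈ P j ∧ q ∈ P i :=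
      fun i j p q hij hR h1 h2 => ⟨h.mem _ _ _ _ hij.symm (h.symm _ _ _ _ hR) h2,
        h.mem _ _ _ _ hij hR h1⟩
    rcases h.no3 (a := 0) (b := 1) (c := 2) (by decide) (by decide) (by decide) hp hq hr hpq hpr hqr
      with h' | h' | h'
    · exact h1 (m _ _ _ _ (by decide) h' hp hq)
    · exact h2 (m _ _ _ _ (by decide) h' hp hr)
    · exact h3 (m _ _ _ _ (by decide) h' hq hr)

/-- The subgraph of edges colored `p` or `q`. -/
def twoCol {V : Type*} (G : SimpleGraph V) (c : Sym2 V → Fin 6) (p q : Fin 6) : SimpleGraph V where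
  Adj u v := G.Adj u v ∧ (c s(u, v) = p ∨ c s(u, v) = q)
  symm := ⟨by
    rintro u v ⟨h, h'⟩
    refine ⟨h.symm, ?_⟩
    rwa [Sym2.eq_swap]⟩
  loopless := ⟨fun u h => G.loopless.irrefl u h.1⟩

/-- Internal form of a proper acyclic edge coloring. -/
structure Nice {V : Type*} (G : SimpleGraph V) (c : Sym2 V → Fin 6) : Prop where
  proper : ∀ u v w, G.Adj u v → G.Adj u w → c s(u, v) = c s(u, w) → v = w
  acyc : ∀ p q, (twoCol G c p q).IsAcyclic

/-- The palette of a vertex. -/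
noncomputable def pal {V : Type*} (G : SimpleGraph V) (c : Sym2 V → Fin 6) (y : V) :
    Finset (Fin 6) := by
  classical exact Finset.univ.filter fun γ => ∃ w, G.Adj y w ∧ c s(y, w) = γ

theorem mem_pal {V : Type*} {G : SimpleGraph V} {c : Sym2 V → Fin 6} {y : V} {γ : Fin 6} :
    γ ∈ pal G c y ↔ ∃ w, G.Adj y w ∧ c s(y, w) = γ := by
  classical
  simp [pal]

theorem pal_card_le {V : Type*} [Fintype V] {G : SimpleGraph V} {c : Sym2 V → Fin 6} {y : V}
    {N : Finset V} (hN : ∀ w, G.Adj y w → w ∈ N) : (pal G c y).card ≤ N.card := by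
  classical
  refine (Finset.card_le_card (t := N.image fun w => c s(y, w)) ?_).trans Finset.card_image_le
  intro γ hγ
  obtain ⟨w, hw, rfl⟩ := mem_pal.1 hγ
  exact Finset.mem_image_of_mem _ (hN w hw)

theorem twoCol_comm {V : Type*} (G : SimpleGraph V) (c : Sym2 V → Fin 6) (p q : Fin 6) :
    twoCol G c p q = twoCol G c q p := by
  ext u v
  simp only [twoCol, or_comm]

/-- Splitting a cycle at a vertex. -/
theorem cycle_split {V : Type*} {K : SimpleGraph V} {v x : V} {p : K.Walk v v} (hp : p.IsCycle)
    (hx : x ∈ p.support) : ∃ y z, y ≠ z ∧ K.Adj x y ∧ K.Adj x z ∧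
      ∃ w : K.Walk y z, x ∉ w.support := by
  classical
  have hr := (SimpleGraph.Walk.isCycle_rotate (u := x) (hu := hx)).2 hp
  generalize p.rotate x hx = p' at hr
  cases p' with
  | nil => simp at hr
  | @cons _ y _ h p1 =>
    rw [SimpleGraph.Walk.cons_isCycle_iff] at hr
    obtain ⟨h1, h2⟩ := hr
    have h3 := h1.reverse
    have h4 : s(x, y) ∉ p1.reverse.edges := by simpa using h2
    generalize p1.reverse = p2 at h3 h4
    cases p2 with
    | nil => exact (K.loopless.irrefl _ h).elim
    | @cons _ z _ h' p3 =>
      rw [SimpleGraph.Walk.cons_isPath_iff] at h3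
      refine ⟨z, y, ?_, h', h, p3, h3.2⟩
      rintro rfl
      simp at h4

/-- Two paths which agree so far cannot end in different endpoints. -/
theorem two_ends {V : Type*} {K : SimpleGraph V} {x2 x3 : V} (h23 : x2 ≠ x3)
    (hdeg : ∀ u a b d, K.Adj u a → K.Adj u b → K.Adj u d → a = b ∨ a = d ∨ b = d)
    (h2 : ∀ u v, K.Adj x2 u → K.Adj x2 v → u = v) (h3 : ∀ u v, K.Adj x3 u → K.Adj x3 v → u = v)
    {u : V} (p : K.Walk u x2) : ∀ (q : K.Walk u x3) (t : V), p.IsPath → q.IsPath → K.Adj u t →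
      t ∉ p.support → t ∉ q.support → False := by
  induction p with
  | nil =>
    intro q t hp hq ht htp htq
    cases q with
    | nil => exact h23 rfl
    | @cons _ w _ h q1 =>
      have := h2 _ _ h ht
      subst this
      simp at htq
  | @cons u v _ h p1 ih =>
    intro q t hp hq ht htp htq
    cases q with
    | nil =>
      have := h3 _ _ h ht
      subst this
      simp at htp
    | @cons _ w _ h' q1 =>
      have hvt : v ≠ t := by rintro rfl; simp at htp
      have hwt : w ≠ t := by rintro rfl; simp at htq
      have hvw : v = w := by
        rcases hdeg u v w t h h' ht with h | h | h
        · exact h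
        · exact absurd h hvt
        · exact absurd h hwt
      subst hvw
      rw [SimpleGraph.Walk.cons_isPath_iff] at hp hq
      exact ih h23 h2 q1 u hp.1 hq.1 h.symm hp.2 hq.2

theorem three_ends {V : Type*} {K : SimpleGraph V} {x1 x2 x3 : V} (h12 : x1 ≠ x2) (h13 : x1 ≠ x3)
    (h23 : x2 ≠ x3)
    (hdeg : ∀ u a b d, K.Adj u a → K.Adj u b → K.Adj u d → a = b ∨ a = d ∨ b = d)
    (h1 : ∀ u v, K.Adj x1 u → K.Adj x1 v → u = v)
    (h2 : ∀ u v, K.Adj x2 u → K.Adj x2 v → u = v) (h3 : ∀ u v, K.Adj x3 u → K.Adj x3 v → u = v)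
    (r2 : K.Reachable x1 x2) (r3 : K.Reachable x1 x3) : False := by
  obtain ⟨p, hp⟩ := r2.exists_isPath
  obtain ⟨q, hq⟩ := r3.exists_isPath
  cases p with
  | nil => exact h12 rfl
  | @cons _ v _ h p1 =>
    cases q with
    | nil => exact h13 rfl
    | @cons _ w _ h' q1 =>
      have hvw := h1 _ _ h h'
      subst hvw
      rw [SimpleGraph.Walk.cons_isPath_iff] at hp hq
      exact two_ends h23 hdeg h2 h3 p1 q1 x1 hp.1 hq.1 h.symm hp.2 hq.2

theorem Nice.deg2 {V : Type*} {G : SimpleGraph V} {c : Sym2 V → Fin 6} (h : Nice G c) (p q : Fin 6) :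
    ∀ u a b d, (twoCol G c p q).Adj u a → (twoCol G c p q).Adj u b → (twoCol G c p q).Adj u d →
      a = b ∨ a = d ∨ b = d := by
  rintro u a b d ⟨ha, ha'⟩ ⟨hb, hb'⟩ ⟨hd, hd'⟩
  have h1 := h.proper u a b ha hb
  have h2 := h.proper u a d ha hd
  have h3 := h.proper u b d hb hd
  grind

theorem Nice.deg1 {V : Type*} {G : SimpleGraph V} {c : Sym2 V → Fin 6} (h : Nice G c) {p q : Fin 6}
    {x : V} (hx : p ∉ pal G c x ∨ q ∉ pal G c x) :
    ∀ u v, (twoCol G c p q).Adj x u → (twoCol G c p q).Adj x v → u = v := by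
  rintro a b ⟨ha, ha'⟩ ⟨hb, hb'⟩
  have h1 := h.proper x a b ha hb
  simp only [mem_pal, not_exists, not_and] at hx
  grind

theorem Nice.three {V : Type*} {G : SimpleGraph V} {c : Sym2 V → Fin 6} (h : Nice G c) {p q : Fin 6}
    {x1 x2 x3 : V} (h12 : x1 ≠ x2) (h13 : x1 ≠ x3) (h23 : x2 ≠ x3)
    (h1 : p ∉ pal G c x1 ∨ q ∉ pal G c x1) (h2 : p ∉ pal G c x2 ∨ q ∉ pal G c x2)
    (h3 : p ∉ pal G c x3 ∨ q ∉ pal G c x3) (r2 : (twoCol G c p q).Reachable x1 x2)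
    (r3 : (twoCol G c p q).Reachable x1 x3) : False :=
  three_ends h12 h13 h23 (h.deg2 p q) (h.deg1 h1) (h.deg1 h2) (h.deg1 h3) r2 r3

/-- The coloring extended to the edges at `x`. -/
def extCol {V : Type*} [DecidableEq V] (c : Sym2 V → Fin 6) (x : V) (f : V → Fin 6) :
    Sym2 V → Fin 6 :=
  Sym2.lift ⟨fun u v => if u = x then f v else if v = x then f u else c s(u, v), by
    intro u v
    by_cases hu : u = x <;> by_cases hv : v = x <;> simp [hu, hv, Sym2.eq_swap]⟩

theorem extCol_left {V : Type*} [DecidableEq V] (c : Sym2 V → Fin 6) (x : V) (f : V → Fin 6) (v : V) :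
    extCol c x f s(x, v) = f v := by simp [extCol]

theorem extCol_right {V : Type*} [DecidableEq V] (c : Sym2 V → Fin 6) (x : V) (f : V → Fin 6) (v : V) :
    extCol c x f s(v, x) = f v := by rw [Sym2.eq_swap, extCol_left]

theorem extCol_else {V : Type*} [DecidableEq V] (c : Sym2 V → Fin 6) (x : V) (f : V → Fin 6) (u v : V)
    (hu : u ≠ x) (hv : v ≠ x) : extCol c x f s(u, v) = c s(u, v) := by simp [extCol, hu, hv]

theorem extend_nice {V : Type*} [DecidableEq V] {G H : SimpleGraph V} {c : Sym2 V → Fin 6} {x : V}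
    (hH : ∀ u v, H.Adj u v ↔ G.Adj u v ∧ u ≠ x ∧ v ≠ x) (hc : Nice H c) (f : V → Fin 6)
    (hf1 : ∀ y, G.Adj x y → f y ∉ pal H c y)
    (hf2 : ∀ y z, G.Adj x y → G.Adj x z → f y = f z → y = z)
    (hf3 : ∀ y z, G.Adj x y → G.Adj x z → y ≠ z → ¬ (twoCol H c (f y) (f z)).Reachable y z) :
    Nice G (extCol c x f) := by
  have tr : ∀ p q u v, u ≠ x → v ≠ x → (twoCol G (extCol c x f) p q).Adj u v →
      (twoCol H c p q).Adj u v := by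
    rintro p q u v hu hv ⟨h1, h2⟩
    rw [extCol_else _ _ _ _ _ hu hv] at h2
    exact ⟨(hH _ _).2 ⟨h1, hu, hv⟩, h2⟩
  have tw : ∀ p q u v (w : (twoCol G (extCol c x f) p q).Walk u v), x ∉ w.support →
      ∀ e ∈ w.edges, e ∈ (twoCol H c p q).edgeSet := by
    intro p q u v w hw e he
    induction e with
    | _ a b =>
      rw [SimpleGraph.mem_edgeSet]
      refine tr p q a b ?_ ?_ (w.adj_of_mem_edges he)
      · rintro rfl; exact hw (w.fst_mem_support_of_mem_edges he)
      · rintro rfl; exact hw (w.snd_mem_support_of_mem_edges he)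
  constructor
  · intro u v w huv huw h
    by_cases hu : u = x
    · subst hu
      rw [extCol_left, extCol_left] at h
      exact hf2 _ _ huv huw h
    · by_cases hv : v = x
      · subst hv
        by_cases hw : w = v
        · exact hw.symm
        · rw [extCol_right, extCol_else _ _ _ _ _ hu hw] at h
          exact (hf1 u huv.symm (mem_pal.2 ⟨w, (hH _ _).2 ⟨huw, hu, hw⟩, h.symm⟩)).elim
      · by_cases hw : w = x
        · subst hw
          rw [extCol_right, extCol_else _ _ _ _ _ hu hv] at h
          exact (hf1 u huw.symm (mem_pal.2 ⟨v, (hH _ _).2 ⟨huv, hu, hv⟩, h⟩)).elim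
        · rw [extCol_else _ _ _ _ _ hu hw, extCol_else _ _ _ _ _ hu hv] at h
          exact hc.proper u v w ((hH _ _).2 ⟨huv, hu, hv⟩) ((hH _ _).2 ⟨huw, hu, hw⟩) h
  · intro p q v C hC
    by_cases hx : x ∈ C.support
    · obtain ⟨y, z, hyz, hy, hz, w, hw⟩ := cycle_split hC hx
      have hr : (twoCol H c p q).Reachable y z := ⟨w.transfer _ (tw p q y z w hw)⟩
      obtain ⟨hy1, hy2⟩ := hy
      obtain ⟨hz1, hz2⟩ := hz
      rw [extCol_left] at hy2 hz2
      have hne : f y ≠ f z := fun h => hyz (hf2 y z hy1 hz1 h)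
      have h3 := hf3 y z hy1 hz1 hyz
      rcases hy2 with hy2 | hy2 <;> rcases hz2 with hz2 | hz2
      · exact hne (hy2.trans hz2.symm)
      · rw [hy2, hz2] at h3; exact h3 hr
      · rw [hy2, hz2, twoCol_comm] at h3; exact h3 hr
      · exact hne (hy2.trans hz2.symm)
    · exact hc.acyc p q _ (hC.transfer (tw p q v v C hx))

/-- The coloring with the colors of two edges at `y` exchanged. -/
def swapCol {V : Type*} [DecidableEq V] (c : Sym2 V → Fin 6) (y u1 u2 : V) : Sym2 V → Fin 6 :=
  fun e => if e = s(y, u1) then c s(y, u2) else if e = s(y, u2) then c s(y, u1) else c e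

theorem pal_swap {V : Type*} [DecidableEq V] {G : SimpleGraph V} {c : Sym2 V → Fin 6} {y u1 u2 : V}
    (t : V) (h1 : t ≠ u1) (h2 : t ≠ u2) (a1 : G.Adj y u1) (a2 : G.Adj y u2) :
    pal G (swapCol c y u1 u2) t = pal G c t := by
  by_cases hty : t = y
  · subst hty
    ext γ
    simp only [mem_pal]
    constructor
    · rintro ⟨w, hw, h⟩
      by_cases e1 : w = u1
      · subst e1; exact ⟨u2, a2, by simpa [swapCol] using h⟩
      by_cases e2 : w = u2
      · subst e2; exact ⟨u1, a1, by simpa [swapCol, e1, h1, h2] using h⟩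
      · exact ⟨w, hw, by simpa [swapCol, e1, e2, h1, h2] using h⟩
    · rintro ⟨w, hw, h⟩
      by_cases e1 : w = u1
      · subst e1
        by_cases e2 : u2 = w
        · subst e2; exact ⟨u2, a2, by simpa [swapCol] using h⟩
        · exact ⟨u2, a2, by simpa [swapCol, e2, h1, h2] using h⟩
      by_cases e2 : w = u2
      · subst e2; exact ⟨u1, a1, by simpa [swapCol] using h⟩
      · exact ⟨w, hw, by simpa [swapCol, e1, e2, h1, h2] using h⟩
  · have : ∀ w, swapCol c y u1 u2 s(t, w) = c s(t, w) := by
      intro w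
      simp [swapCol, hty, h1, h2]
    ext γ
    simp only [mem_pal, this]

theorem cycle_colors {V : Type*} {G : SimpleGraph V} {c : Sym2 V → Fin 6}
    (hpr : ∀ u v w, G.Adj u v → G.Adj u w → c s(u, v) = c s(u, w) → v = w) {p q : Fin 6} {v x : V}
    {C : (twoCol G c p q).Walk v v} (hC : C.IsCycle) (hx : x ∈ C.support) :
    p ∈ pal G c x ∧ q ∈ pal G c x ∧ p ≠ q := by
  obtain ⟨y, z, hyz, ⟨hy1, hy2⟩, ⟨hz1, hz2⟩, -⟩ := cycle_split hC hx
  have hne : c s(x, y) ≠ c s(x, z) := fun h => hyz (hpr x y z hy1 hz1 h)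
  rcases hy2 with hy2 | hy2 <;> rcases hz2 with hz2 | hz2
  · exact (hne (hy2.trans hz2.symm)).elim
  · exact ⟨mem_pal.2 ⟨y, hy1, hy2⟩, mem_pal.2 ⟨z, hz1, hz2⟩, by rw [← hy2, ← hz2]; exact hne⟩
  · exact ⟨mem_pal.2 ⟨z, hz1, hz2⟩, mem_pal.2 ⟨y, hy1, hy2⟩, by rw [← hy2, ← hz2]; exact hne.symm⟩
  · exact (hne (hy2.trans hz2.symm)).elim

theorem swapCol_comm {V : Type*} [DecidableEq V] (c : Sym2 V → Fin 6) (y u1 u2 : V) :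
    swapCol c y u1 u2 = swapCol c y u2 u1 := by
  funext e
  unfold swapCol
  by_cases h1 : e = s(y, u1) <;> by_cases h2 : e = s(y, u2)
  · have h3 : s(y, u1) = s(y, u2) := h1.symm.trans h2
    rw [if_pos h1, if_pos h2, h3]
  · rw [if_pos h1, if_neg h2, if_pos h1]
  · rw [if_neg h1, if_pos h2, if_pos h2]
  · rw [if_neg h1, if_neg h2, if_neg h2, if_neg h1]

theorem swapCol_fst {V : Type*} [DecidableEq V] (c : Sym2 V → Fin 6) (y u1 u2 : V) :
    swapCol c y u1 u2 s(u1, y) = c s(y, u2) := by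
  rw [Sym2.eq_swap]; simp [swapCol]

theorem swapCol_fst_else {V : Type*} [DecidableEq V] (c : Sym2 V → Fin 6) (y u1 u2 w : V)
    (h : u1 ≠ y) (hw : w ≠ y) : swapCol c y u1 u2 s(u1, w) = c s(u1, w) := by
  simp [swapCol, h, hw]

theorem swapCol_else {V : Type*} [DecidableEq V] (c : Sym2 V → Fin 6) (y u1 u2 a b : V)
    (ha : a ≠ y) (hb : b ≠ y) : swapCol c y u1 u2 s(a, b) = c s(a, b) := by
  simp [swapCol, ha, hb]

theorem swap_pal_fst {V : Type*} [DecidableEq V] {G : SimpleGraph V} {c : Sym2 V → Fin 6} {y u1 u2 : V}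
    (hc : Nice G c) (a1 : G.Adj y u1) {γ : Fin 6} (hγ : γ ∈ pal G (swapCol c y u1 u2) u1) :
    γ = c s(y, u2) ∨ (γ ∈ pal G c u1 ∧ γ ≠ c s(y, u1)) := by
  obtain ⟨w, hw, rfl⟩ := mem_pal.1 hγ
  by_cases h : w = y
  · subst h; left; rw [swapCol_fst]
  · right
    rw [swapCol_fst_else _ _ _ _ _ a1.ne.symm h]
    refine ⟨mem_pal.2 ⟨w, hw, rfl⟩, fun h' => h ?_⟩
    apply hc.proper u1 w y hw a1.symm
    rw [h', Sym2.eq_swap]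

theorem swap_proper_fst {V : Type*} [DecidableEq V] {G : SimpleGraph V} {c : Sym2 V → Fin 6}
    {y u1 u2 : V} (hc : Nice G c) (a1 : G.Adj y u1) (hq : c s(y, u2) ∉ pal G c u1) :
    ∀ v w, G.Adj u1 v → G.Adj u1 w →
      swapCol c y u1 u2 s(u1, v) = swapCol c y u1 u2 s(u1, w) → v = w := by
  intro v w hv hw h
  have hne := a1.ne.symm
  by_cases h1 : v = y
  · by_cases h2 : w = y
    · rw [h1, h2]
    · subst h1
      rw [swapCol_fst, swapCol_fst_else _ _ _ _ _ hne h2] at h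
      exact (hq (mem_pal.2 ⟨w, hw, h.symm⟩)).elim
  · by_cases h2 : w = y
    · subst h2
      rw [swapCol_fst, swapCol_fst_else _ _ _ _ _ hne h1] at h
      exact (hq (mem_pal.2 ⟨v, hv, h⟩)).elim
    · rw [swapCol_fst_else _ _ _ _ _ hne h1, swapCol_fst_else _ _ _ _ _ hne h2] at h
      exact hc.proper _ _ _ hv hw h

theorem swap_nice {V : Type*} [DecidableEq V] {G : SimpleGraph V} {c : Sym2 V → Fin 6} {y u1 u2 : V}
    (hc : Nice G c) (a1 : G.Adj y u1) (a2 : G.Adj y u2) (h12 : u1 ≠ u2)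
    (h1 : ∀ γ ∈ pal G c u1, γ = c s(y, u1) ∨ γ ∉ pal G c y)
    (h2 : ∀ γ ∈ pal G c u2, γ = c s(y, u2) ∨ γ ∉ pal G c y) :
    Nice G (swapCol c y u1 u2) := by
  have hq : c s(y, u1) ≠ c s(y, u2) := fun h => h12 (hc.proper _ _ _ a1 a2 h)
  have m1 : c s(y, u1) ∈ pal G c y := mem_pal.2 ⟨u1, a1, rfl⟩
  have m2 : c s(y, u2) ∈ pal G c y := mem_pal.2 ⟨u2, a2, rfl⟩
  have py : pal G (swapCol c y u1 u2) y = pal G c y := pal_swap y a1.ne a2.ne a1 a2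
  have hpr : ∀ u v w, G.Adj u v → G.Adj u w →
      swapCol c y u1 u2 s(u, v) = swapCol c y u1 u2 s(u, w) → v = w := by
    intro u v w hv hw h
    by_cases hu1 : u = u1
    · subst hu1
      refine swap_proper_fst hc a1 (fun h' => ?_) v w hv hw h
      rcases h1 _ h' with h'' | h''
      · exact hq h''.symm
      · exact h'' m2
    by_cases hu2 : u = u2
    · subst hu2
      rw [swapCol_comm] at h
      refine swap_proper_fst hc a2 (fun h' => ?_) v w hv hw h
      rcases h2 _ h' with h'' | h''
      · exact hq h''
      · exact h'' m1
    by_cases hy : u = y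
    · subst hy
      have e : ∀ t, swapCol c u u1 u2 s(u, t) =
          if t = u1 then c s(u, u2) else if t = u2 then c s(u, u1) else c s(u, t) := by
        intro t; simp [swapCol, hu1, hu2]
      rw [e, e] at h
      have p1 := hc.proper u v w hv hw
      have p2 := hc.proper u v u1 hv a1
      have p3 := hc.proper u v u2 hv a2
      have p4 := hc.proper u w u1 hw a1
      have p5 := hc.proper u w u2 hw a2
      grind
    · have e : ∀ t, swapCol c y u1 u2 s(u, t) = c s(u, t) := by
        intro t; simp [swapCol, hu1, hu2, hy]
      rw [e, e] at h
      exact hc.proper u v w hv hw h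
  refine ⟨hpr, ?_⟩
  intro p q v C hC
  have n1 : s(y, u1) ∉ C.edges := by
    intro he
    obtain ⟨b1, b2, b3⟩ := cycle_colors hpr hC (C.fst_mem_support_of_mem_edges he)
    obtain ⟨d1, d2, -⟩ := cycle_colors hpr hC (C.snd_mem_support_of_mem_edges he)
    rw [py] at b1 b2
    have hcol := (C.adj_of_mem_edges he).2
    rw [Sym2.eq_swap, swapCol_fst] at hcol
    have f1 := swap_pal_fst hc a1 d1
    have f2 := swap_pal_fst hc a1 d2
    have g1 := h1 p
    have g2 := h1 q
    grind
  have n2 : s(y, u2) ∉ C.edges := by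
    intro he
    obtain ⟨b1, b2, b3⟩ := cycle_colors hpr hC (C.fst_mem_support_of_mem_edges he)
    obtain ⟨d1, d2, -⟩ := cycle_colors hpr hC (C.snd_mem_support_of_mem_edges he)
    rw [py] at b1 b2
    have hcol := (C.adj_of_mem_edges he).2
    rw [swapCol_comm, Sym2.eq_swap, swapCol_fst] at hcol
    rw [swapCol_comm] at d1 d2
    have f1 := swap_pal_fst hc a2 d1
    have f2 := swap_pal_fst hc a2 d2
    have g1 := h2 p
    have g2 := h2 q
    grind
  refine hc.acyc p q _ (hC.transfer (H := twoCol G c p q) ?_)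
  intro e he
  have e1 : e ≠ s(y, u1) := by rintro rfl; exact n1 he
  have e2 : e ≠ s(y, u2) := by rintro rfl; exact n2 he
  have e3 : swapCol c y u1 u2 e = c e := by simp [swapCol, e1, e2]
  induction e with
  | _ a b =>
    obtain ⟨h, h'⟩ := C.adj_of_mem_edges he
    rw [e3] at h'
    exact ⟨h, h'⟩

/-- Palettes of the (at most three) neighbors of `x`. -/
noncomputable def nbPal {V : Type*} (H : SimpleGraph V) (v : Fin 3 → Option V) (c : Sym2 V → Fin 6)
    (i : Fin 3) : Finset (Fin 6) := (v i).elim ∅ (pal H c)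

/-- Bichromatic connections among the neighbors of `x`. -/
def nbRel {V : Type*} (H : SimpleGraph V) (v : Fin 3 → Option V) (c : Sym2 V → Fin 6)
    (i j : Fin 3) (p q : Fin 6) : Prop :=
  ∃ y z, v i = some y ∧ v j = some z ∧ (twoCol H c p q).Reachable y z

theorem nbPal_some {V : Type*} {H : SimpleGraph V} {v : Fin 3 → Option V} {c : Sym2 V → Fin 6}
    {i : Fin 3} {y : V} (h : v i = some y) : nbPal H v c i = pal H c y := by
  simp [nbPal, h]

theorem stuck_of {V : Type*} [DecidableEq V] {G H : SimpleGraph V} {x : V}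
    (hH : ∀ u v, H.Adj u v ↔ G.Adj u v ∧ u ≠ x ∧ v ≠ x) (v : Fin 3 → Option V)
    (hv1 : ∀ w, G.Adj x w → ∃ i, v i = some w)
    (hv3 : ∀ i j y, v i = some y → v j = some y → i = j)
    (hno : ¬ ∃ c, Nice G c) {c : Sym2 V → Fin 6} (hc : Nice H c) :
    Stuck (nbPal H v c) (nbRel H v c) := by
  constructor
  · rintro i j p q ⟨y, z, hy, hz, h⟩
    exact ⟨z, y, hz, hy, by rw [twoCol_comm]; exact h.symm⟩
  · rintro i j p q ⟨y, z, hy, hz, h⟩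
    exact ⟨y, z, hy, hz, by rwa [twoCol_comm]⟩
  · rintro i j p q hij ⟨y, z, hy, hz, ⟨w⟩⟩ hp
    rw [nbPal_some hy] at hp ⊢
    cases w with
    | nil => exact (hij (hv3 _ _ _ hy hz)).elim
    | @cons _ t _ h w' =>
      obtain ⟨h1, h2 | h2⟩ := h
      · exact (hp (mem_pal.2 ⟨t, h1, h2⟩)).elim
      · exact mem_pal.2 ⟨t, h1, h2⟩
  · rintro i j k p q hij hik hjk ⟨y, z, hy, hz, h⟩ ⟨y', t, hy', ht, h'⟩ b1 b2 b3
    rw [nbPal_some hy] at b1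
    rw [nbPal_some hz] at b2
    rw [nbPal_some ht] at b3
    obtain rfl : y = y' := by rw [hy] at hy'; exact Option.some.inj hy'
    refine hc.three ?_ ?_ ?_ b1 b2 b3 h h'
    · rintro rfl; exact hij (hv3 _ _ _ hy hz)
    · rintro rfl; exact hik (hv3 _ _ _ hy ht)
    · rintro rfl; exact hjk (hv3 _ _ _ hz ht)
  · intro f hf hfP
    by_contra! hR
    apply hno
    have hF : ∃ F : V → Fin 6, ∀ i y, v i = some y → F y = f i := by
      classical
      refine ⟨fun y => if h : ∃ i, v i = some y then f h.choose else 0, ?_⟩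
      intro i y hi
      have h : ∃ i, v i = some y := ⟨i, hi⟩
      simp only [h, dif_pos]
      rw [hv3 _ _ _ h.choose_spec hi]
    obtain ⟨F, hF⟩ := hF
    refine ⟨_, extend_nice hH hc F ?_ ?_ ?_⟩
    · intro y hy
      obtain ⟨i, hi⟩ := hv1 y hy
      rw [hF i y hi, ← nbPal_some hi]
      exact hfP i
    · intro y z hy hz h
      obtain ⟨i, hi⟩ := hv1 y hy
      obtain ⟨j, hj⟩ := hv1 z hz
      rw [hF i y hi, hF j z hj] at h
      obtain rfl := hf h
      rw [hi] at hj
      exact Option.some.inj hj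
    · intro y z hy hz hyz h
      obtain ⟨i, hi⟩ := hv1 y hy
      obtain ⟨j, hj⟩ := hv1 z hz
      rw [hF i y hi, hF j z hj] at h
      refine hR i j ?_ ⟨y, z, hi, hj, h⟩
      rintro rfl
      rw [hi] at hj
      exact hyz (Option.some.inj hj)

/-- The inductive step. -/
theorem step {V : Type*} [Fintype V] [DecidableEq V] {G H : SimpleGraph V} {x : V}
    (hH : ∀ u v, H.Adj u v ↔ G.Adj u v ∧ u ≠ x ∧ v ≠ x)
    (hdeg : ∀ y, ∃ N : Finset V, N.card ≤ 4 ∧ ∀ w, G.Adj y w → w ∈ N)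
    (hx : ∃ N : Finset V, N.card ≤ 3 ∧ ∀ w, G.Adj x w → w ∈ N)
    {c : Sym2 V → Fin 6} (hc : Nice H c) : ∃ c', Nice G c' := by
  by_contra hno
  -- enumerate the neighbors
  obtain ⟨v, hv1, hv2, hv3⟩ : ∃ v : Fin 3 → Option V, (∀ w, G.Adj x w → ∃ i, v i = some w) ∧
      (∀ i y, v i = some y → G.Adj x y) ∧ (∀ i j y, v i = some y → v j = some y → i = j) := by
    classical
    obtain ⟨N, hN, hN'⟩ := hx
    set M := N.filter (G.Adj x) with hM
    have hMc : M.card ≤ 3 := (Finset.card_filter_le _ _).trans hN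
    refine ⟨fun i => M.toList[(i : ℕ)]?, ?_, ?_, ?_⟩
    · intro w hw
      have : w ∈ M.toList := by simp [hM, hw, hN']
      obtain ⟨n, hn, h⟩ := List.mem_iff_getElem.1 this
      have hn' : n < 3 := by simp at hn; omega
      exact ⟨⟨n, hn'⟩, List.getElem?_eq_some_iff.2 ⟨hn, h⟩⟩
    · intro i y hy
      have := List.mem_of_getElem? hy
      simp [hM] at this
      exact this.2
    · intro i j y hi hj
      simp only [List.getElem?_eq_some_iff] at hi hj
      obtain ⟨h1, h2⟩ := hi
      obtain ⟨h3, h4⟩ := hj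
      have := (List.Nodup.getElem_inj_iff M.nodup_toList (hi := h1) (hj := h3)).1 (h2.trans h4.symm)
      exact Fin.ext this
  have palx : ∀ (c : Sym2 V → Fin 6) i y, v i = some y → (pal H c y).card ≤ 3 := by
    intro c i y hy
    obtain ⟨N, hN, hN'⟩ := hdeg y
    have hxN : x ∈ N := hN' x (hv2 _ _ hy).symm
    have := pal_card_le (G := H) (c := c) (y := y) (N := N.erase x) (by
      intro w hw
      obtain ⟨h1, h2, h3⟩ := (hH _ _).1 hw
      exact Finset.mem_erase.2 ⟨h3, hN' w h1⟩)
    rw [Finset.card_erase_of_mem hxN] at this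
    omega
  have pal4 : ∀ (c : Sym2 V → Fin 6) y, (pal H c y).card ≤ 4 := by
    intro c y
    obtain ⟨N, hN, hN'⟩ := hdeg y
    exact (pal_card_le (fun w hw => hN' w ((hH _ _).1 hw).1)).trans hN
  have cardP : ∀ i, (nbPal H v c i).card ≤ 3 := by
    intro i
    cases h : v i with
    | none => simp [nbPal, h]
    | some y => rw [nbPal_some h]; exact palx c i y h
  obtain ⟨k, hk⟩ := exists_pivot (nbPal H v c) cardP
  obtain ⟨hk3, hkR⟩ := hk _ (stuck_of hH v hv1 hv3 hno hc)
  obtain ⟨y, hy⟩ : ∃ y, v k = some y := by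
    cases h : v k with
    | none => simp [nbPal, h] at hk3
    | some y => exact ⟨y, rfl⟩
  have hPk := nbPal_some (H := H) (c := c) hy
  rw [hPk] at hk3
  obtain ⟨q1, q2, q3, h12, h13, h23, hQ⟩ := Finset.card_eq_three.1 hk3
  have m1 : q1 ∈ pal H c y := by simp [hQ]
  have m2 : q2 ∈ pal H c y := by simp [hQ]
  have m3 : q3 ∈ pal H c y := by simp [hQ]
  -- unpack the connections
  have hconn : ∀ r, r ∉ pal H c y → ∃ z zz, z ≠ k ∧ v z = some zz ∧ y ≠ zz ∧
      (∀ q ∈ pal H c y, q ∉ pal H c zz) ∧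
      ∀ q ∈ pal H c y, (twoCol H c r q).Reachable y zz := by
    intro r hr
    obtain ⟨z, hzk, hd, hz⟩ := hkR r (by rwa [hPk])
    rw [hPk] at hz hd
    obtain ⟨y', zz, hy', hzz, -⟩ := hz q1 m1
    rw [nbPal_some hzz] at hd
    refine ⟨z, zz, hzk, hzz, ?_, ?_, ?_⟩
    · rintro rfl; exact hzk (hv3 _ _ _ hzz hy)
    · intro q hq hq'; exact Finset.disjoint_left.1 hd hq' hq
    · intro q hq
      obtain ⟨y'', zz', h1, h2, h3⟩ := hz q hq
      rw [hy] at h1; rw [hzz] at h2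
      obtain rfl := Option.some.inj h1
      obtain rfl := Option.some.inj h2
      exact h3
  -- palettes of the neighbors of `y`
  have hnb : ∀ u, H.Adj y u → (pal H c u).card = 4 ∧
      ∀ γ ∈ pal H c u, γ = c s(y, u) ∨ γ ∉ pal H c y := by
    intro u hu
    have hqy : c s(y, u) ∈ pal H c y := mem_pal.2 ⟨u, hu, rfl⟩
    have hqu : c s(y, u) ∈ pal H c u := mem_pal.2 ⟨y, hu.symm, by rw [Sym2.eq_swap]⟩
    have hsub : insert (c s(y, u)) (pal H c y)ᶜ ⊆ pal H c u := by
      intro r hr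
      rcases Finset.mem_insert.1 hr with rfl | hr
      · exact hqu
      · rw [Finset.mem_compl] at hr
        by_contra hru
        obtain ⟨z, zz, hzk, hzz, hne, hd, hR⟩ := hconn r hr
        refine hc.three hu.ne hne ?_ (Or.inl hr) (Or.inl hru) (Or.inr (hd _ hqy)) ?_ (hR _ hqy)
        · rintro rfl; exact hd _ hqy hqu
        · exact SimpleGraph.Adj.reachable ⟨hu, Or.inr rfl⟩
    have hcard : (insert (c s(y, u)) (pal H c y)ᶜ).card = 4 := by
      rw [Finset.card_insert_of_notMem (by simpa using hqy)]
      have := Finset.card_compl_add_card (pal H c y)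
      simp only [Fintype.card_fin] at this
      omega
    have heq := Finset.eq_of_subset_of_card_le hsub (by rw [hcard]; exact pal4 c u)
    refine ⟨by rw [← heq]; exact hcard, ?_⟩
    intro γ hγ
    rw [← heq, Finset.mem_insert, Finset.mem_compl] at hγ
    exact hγ
  obtain ⟨u1, a1, c1⟩ := mem_pal.1 m1
  obtain ⟨u2, a2, c2⟩ := mem_pal.1 m2
  have u12 : u1 ≠ u2 := by rintro rfl; exact h12 (c1.symm.trans c2)
  have notnb : ∀ u, H.Adj y u → ∀ i t, v i = some t → t ≠ u := by
    rintro u hu i t ht rfl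
    have := palx c i t ht
    have := (hnb t hu).1
    omega
  have hc' := swap_nice hc a1 a2 u12 (hnb u1 a1).2 (hnb u2 a2).2
  set c' := swapCol c y u1 u2 with hc'def
  have palc' : ∀ i t, v i = some t → pal H c' t = pal H c t := fun i t ht =>
    pal_swap t (notnb u1 a1 i t ht) (notnb u2 a2 i t ht) a1 a2
  have hP : nbPal H v c' = nbPal H v c := by
    funext i
    cases h : v i with
    | none => simp [nbPal, h]
    | some t => rw [nbPal_some h, nbPal_some h, palc' i t h]
  have hst' := stuck_of hH v hv1 hv3 hno hc'
  rw [hP] at hst'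
  obtain ⟨-, hkR'⟩ := hk _ hst'
  obtain ⟨r, hr, -⟩ := exists_notin_two hk3.le q1 q1
  obtain ⟨z, zz, hzk, hzz, hne, hd, hR⟩ := hconn r hr
  obtain ⟨z', hzk', hd', hR'⟩ := hkR' r (by rwa [hPk])
  rw [hPk] at hR' hd'
  have hr1 : r ≠ q1 := by rintro rfl; exact hr m1
  have hr2 : r ≠ q2 := by rintro rfl; exact hr m2
  -- the `(r, q3)` graph is unchanged
  have same : twoCol H c' r q3 = twoCol H c r q3 := by
    ext a b
    have : (c' s(a, b) = r ∨ c' s(a, b) = q3) ↔ (c s(a, b) = r ∨ c s(a, b) = q3) := by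
      rw [hc'def]
      unfold swapCol
      split_ifs with e1 e2
      · rw [e1, c1, c2]; grind
      · rw [e2, c1, c2]; grind
      · rfl
    simp only [twoCol, this]
  have hzz' : z' = z := by
    by_contra hzz'
    obtain ⟨y', t, hy', ht, h⟩ := hR' q3 m3
    rw [hy] at hy'
    obtain rfl := Option.some.inj hy'
    rw [same] at h
    rw [nbPal_some ht] at hd'
    refine hc.three hne ?_ ?_ (Or.inl hr) (Or.inr (hd _ m3))
      (Or.inr (fun h' => Finset.disjoint_left.1 hd' h' m3)) (hR _ m3) h
    · rintro rfl; exact hzk' (hv3 _ _ _ ht hy)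
    · rintro rfl; exact hzz' (hv3 _ _ _ ht hzz)
  subst hzz'
  obtain ⟨y', t, hy', ht, h⟩ := hR' q1 m1
  rw [hy] at hy'
  rw [hzz] at ht
  obtain rfl := Option.some.inj hy'
  obtain rfl := Option.some.inj ht
  have hu1z : (twoCol H c' r q1).Reachable u1 zz := by
    obtain ⟨p, hp⟩ := (hR q1 m1).exists_isPath
    cases p with
    | nil => exact (hne rfl).elim
    | @cons _ w _ hw p1 =>
      rw [SimpleGraph.Walk.cons_isPath_iff] at hp
      obtain ⟨hw1, hw2⟩ := hw
      have hwu : w = u1 := by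
        rcases hw2 with hw2 | hw2
        · exact (hr (mem_pal.2 ⟨w, hw1, hw2⟩)).elim
        · exact hc.proper _ _ _ hw1 a1 (hw2.trans c1.symm)
      subst hwu
      refine ⟨p1.transfer _ ?_⟩
      intro e he
      induction e with
      | _ a b =>
        have ha : a ≠ y := by rintro rfl; exact hp.2 (p1.fst_mem_support_of_mem_edges he)
        have hb : b ≠ y := by rintro rfl; exact hp.2 (p1.snd_mem_support_of_mem_edges he)
        obtain ⟨h1, h2⟩ := p1.adj_of_mem_edges he
        refine ⟨h1, ?_⟩
        rw [hc'def, swapCol_else _ _ _ _ _ _ ha hb]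
        exact h2
  have hq1u1 : q1 ∉ pal H c' u1 := by
    intro h'
    rcases swap_pal_fst hc a1 h' with h'' | h''
    · rw [c2] at h''; exact h12 h''
    · exact h''.2 c1.symm
  refine hc'.three hne.symm (notnb u1 a1 _ _ hzz) a1.ne ?_ ?_ (Or.inr hq1u1) h.symm hu1z.symm
  · right; rw [palc' _ _ hzz]; exact hd _ m1
  · left; rw [palc' _ _ hy]; exact hr

/-- Coloring of degenerate graphs. -/
theorem nice_of_degenerate {V : Type*} [Fintype V] [DecidableEq V] (G : SimpleGraph V)
    [DecidableRel G.Adj]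
    (hdeg : ∀ y, (Finset.univ.filter (G.Adj y)).card ≤ 4)
    (hS : ∀ S : Finset V, S.Nonempty → ∃ x ∈ S, (S.filter (G.Adj x)).card ≤ 3) :
    ∀ (n : ℕ) (S : Finset V), S.card = n → ∀ H : SimpleGraph V,
      (∀ u v, H.Adj u v ↔ G.Adj u v ∧ u ∈ S ∧ v ∈ S) → ∃ c, Nice H c := by
  intro n
  induction n with
  | zero =>
    intro S hSc H hH
    rw [Finset.card_eq_zero] at hSc
    subst hSc
    refine ⟨fun _ => 0, ⟨?_, ?_⟩⟩
    · intro u v w h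
      simp [hH] at h
    · intro p q v C hC
      cases C with
      | nil => simp at hC
      | cons h _ =>
        have := h.1
        simp [hH] at this
  | succ n ih =>
    intro S hSc H hH
    obtain ⟨x, hxS, hx⟩ := hS S (Finset.card_pos.1 (by omega))
    let H' : SimpleGraph V :=
      { Adj := fun u v => H.Adj u v ∧ u ≠ x ∧ v ≠ x
        symm := ⟨fun u v h => ⟨h.1.symm, h.2.2, h.2.1⟩⟩
        loopless := ⟨fun u h => H.loopless.irrefl u h.1⟩ }
    obtain ⟨c, hc⟩ := ih (S.erase x) (by rw [Finset.card_erase_of_mem hxS]; omega) H' (by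
      intro u v
      simp only [H', hH, Finset.mem_erase]
      tauto)
    refine step (x := x) (G := H) (H := H') (fun u v => Iff.rfl) ?_ ⟨_, hx, ?_⟩ hc
    · intro y
      refine ⟨_, hdeg y, fun w hw => ?_⟩
      simp [((hH _ _).1 hw).1]
    · intro w hw
      obtain ⟨h1, h2, h3⟩ := (hH _ _).1 hw
      simp [h1, h3]

/-- **Theorem 1.** Every connected simple graph `G` on `n` vertices with `m ≤ 2n - 1`
edges and maximum degree at most 4 has an acyclic proper edge coloring
using at most 6 colors, i.e. `a'(G) ≤ 6`. -/
theorem acyclic_edge_coloring_six_colors {V : Type*} [Fintype V] [DecidableEq V]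
    (G : SimpleGraph V) [DecidableRel G.Adj]
    (hconn : G.Connected)
    (hm : G.edgeFinset.card ≤ 2 * Fintype.card V - 1)
    (hΔ : G.maxDegree ≤ 4) :
    ∃ c : Sym2 V → ℕ, (∀ e ∈ G.edgeSet, c e < 6) ∧ AcyclicProperEdgeColoring G c := by
  have hdeg : ∀ y, (Finset.univ.filter (G.Adj y)).card ≤ 4 := by
    intro y
    rw [← SimpleGraph.neighborFinset_eq_filter, SimpleGraph.card_neighborFinset_eq_degree]
    exact (G.degree_le_maxDegree y).trans hΔ
  have hS : ∀ S : Finset V, S.Nonempty → ∃ x ∈ S, (S.filter (G.Adj x)).card ≤ 3 := by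
    intro S hSne
    by_cases hSu : S = Finset.univ
    · subst hSu
      by_contra! hcon
      have hsum := G.sum_degrees_eq_twice_card_edges
      have hge : ∑ v : V, 4 ≤ ∑ v, G.degree v := by
        apply Finset.sum_le_sum
        intro v hv
        have := hcon v hv
        rw [← SimpleGraph.neighborFinset_eq_filter, SimpleGraph.card_neighborFinset_eq_degree] at this
        omega
      simp only [Finset.sum_const, Finset.card_univ, smul_eq_mul] at hge
      have := hconn.nonempty
      have := Fintype.card_pos (α := V)
      omega
    · obtain ⟨s, hs⟩ := hSne
      obtain ⟨t, ht⟩ : ∃ t, t ∉ S := by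
        by_contra! h
        exact hSu (Finset.eq_univ_iff_forall.2 h)
      obtain ⟨p⟩ := hconn.preconnected s t
      obtain ⟨d, -, hd1, hd2⟩ := p.exists_boundary_dart (S : Set V) (by simpa using hs) (by simpa using ht)
      refine ⟨d.fst, by simpa using hd1, ?_⟩
      have hlt : S.filter (G.Adj d.fst) ⊂ Finset.univ.filter (G.Adj d.fst) := by
        rw [Finset.ssubset_iff_of_subset (Finset.filter_subset_filter _ (Finset.subset_univ S))]
        exact ⟨d.snd, by simp [d.adj], by simp at hd2; simp [hd2]⟩
      have := Finset.card_lt_card hlt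
      have := hdeg d.fst
      omega
  obtain ⟨c, hc⟩ := nice_of_degenerate G hdeg hS _ Finset.univ rfl G (by simp)
  refine ⟨fun e => (c e : ℕ), fun e _ => (c e).isLt, ?_, ?_⟩
  · rintro e₁ h₁ e₂ h₂ hne ⟨v, ⟨a, rfl⟩, ⟨b, rfl⟩⟩ h
    have := hc.proper v a b h₁ h₂ (Fin.ext h)
    exact hne (by rw [this])
  · rintro v p hp ⟨α, β, hαβ⟩
    have hcol : ∃ p' q' : Fin 6, ∀ e ∈ p.edges, c e = p' ∨ c e = q' := by
      have cand : ∀ γ : ℕ, ∃ g : Fin 6, ∀ f : Fin 6, (f : ℕ) = γ → f = g := by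
        intro γ
        by_cases h : γ < 6
        · exact ⟨⟨γ, h⟩, fun f hf => Fin.ext hf⟩
        · exact ⟨0, fun f hf => by omega⟩
      obtain ⟨g, hg⟩ := cand α
      obtain ⟨g', hg'⟩ := cand β
      exact ⟨g, g', fun e he => (hαβ e he).imp (hg _) (hg' _)⟩
    obtain ⟨p', q', hpq⟩ := hcol
    refine hc.acyc p' q' _ (hp.transfer (H := twoCol G c p' q') ?_)
    intro e he
    have h1 := hpq e he
    have h2 := p.edges_subset_edgeSet he
    induction e with
    | _ a b => exact ⟨h2, h1⟩
end

section
/- Let G be a simple graph with maximum degree Δ(G) ≤ 4. Then the acyclic chromatic index of G satisfies a'(G) ≤ 7, i.e., G has an acyclic proper edge coloring using at most 7 colors. -/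
namespace AEC

/-- The conclusion in the bad configurations. -/
def Concl (M : Fin 4 → Fin 7 → Bool) (R : Fin 7 → Fin 7 → Fin 4 → Fin 4 → Prop) : Prop :=
  ∃ (a d : Fin 4) (e : Fin 7), a ≠ d ∧ (∀ γ, ¬ (M a γ = true ∧ M d γ = true)) ∧
    (∀ i j, M a i = true → M d j = true → R j i a d) ∧
    (∀ u, M u e = false) ∧ ∀ γ, γ ≠ e → ∃ u, u ≠ a ∧ M u γ = true

/-- The star extension problem: if no assignment works then we are in a bad configuration. -/
def P (M : Fin 4 → Fin 7 → Bool) : Prop :=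
  ∀ R : Fin 7 → Fin 7 → Fin 4 → Fin 4 → Prop,
    (∀ α β u v, R α β u v → R β α v u) →
    (∀ α β u u' v, R α β u v → R α β u' v → u = u') →
    (∀ f : Fin 4 → Fin 7, Function.Injective f → (∀ u, M u (f u) = false) →
      ∃ u v, u ≠ v ∧ M u (f v) = true ∧ M v (f u) = true ∧ R (f u) (f v) u v) →
    Concl M R

theorem P_perm (M : Fin 4 → Fin 7 → Bool) (σ : Equiv.Perm (Fin 4)) (τ : Equiv.Perm (Fin 7))
    (h : P (fun u γ => M (σ u) (τ γ))) : P M := by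
  intro R hs hu hn
  obtain ⟨a, d, e, h1, h2, h3, h4, h5⟩ := h (fun α β u v => R (τ α) (τ β) (σ u) (σ v))
    (fun α β u v h => hs _ _ _ _ h)
    (fun α β u u' v h h' => σ.injective (hu _ _ _ _ _ h h'))
    (by
      intro f hf hM
      obtain ⟨u, v, h1, h2, h3, h4⟩ := hn (fun u => τ (f (σ.symm u)))
        (τ.injective.comp (hf.comp σ.symm.injective))
        (by intro u; simpa using hM (σ.symm u))
      refine ⟨σ.symm u, σ.symm v, by simpa using h1, by simpa using h2, by simpa using h3, ?_⟩
      simpa using h4)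
  refine ⟨σ a, σ d, τ e, by simpa using h1, ?_, ?_, ?_, ?_⟩
  · intro γ; simpa using h2 (τ.symm γ)
  · intro i j hi hj; simpa using h3 (τ.symm i) (τ.symm j) (by simpa using hi) (by simpa using hj)
  · intro u; simpa using h4 (σ.symm u)
  · intro γ hγ
    obtain ⟨u, hu1, hu2⟩ := h5 (τ.symm γ) (by intro h; apply hγ; simp [← h])
    exact ⟨σ u, by simpa using hu1, by simpa using hu2⟩

/-- Membership matrix of a list of bit masks (one mask per color). -/
def toM (l : List ℕ) : Fin 4 → Fin 7 → Bool := fun u γ => (l.getD γ.val 0).testBit u.val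

/-- A conflict-free assignment solves the problem. -/
theorem P_good (M : Fin 4 → Fin 7 → Bool) (f : Fin 4 → Fin 7) (hf : Function.Injective f)
    (hM : ∀ u, M u (f u) = false)
    (hc : ∀ u v, u < v → ¬ (M u (f v) = true ∧ M v (f u) = true)) : P M := by
  intro R _ _ hn
  obtain ⟨u, v, h1, h2, h3, _⟩ := hn f hf hM
  rcases lt_or_gt_of_ne h1 with h | h
  · exact absurd ⟨h2, h3⟩ (hc u v h)
  · exact absurd ⟨h3, h2⟩ (hc v u h)

/-- The value of a single-conflict assignment. -/
theorem unit_conflict (M : Fin 4 → Fin 7 → Bool) (R : Fin 7 → Fin 7 → Fin 4 → Fin 4 → Prop)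
    (hs : ∀ α β u v, R α β u v → R β α v u)
    (hn : ∀ f : Fin 4 → Fin 7, Function.Injective f → (∀ u, M u (f u) = false) →
      ∃ u v, u ≠ v ∧ M u (f v) = true ∧ M v (f u) = true ∧ R (f u) (f v) u v)
    (f : Fin 4 → Fin 7) (s t : Fin 4)
    (hf : (∀ u v, f u = f v → u = v) ∧ (∀ u, M u (f u) = false) ∧
      ∀ u v, u < v → M u (f v) = true → M v (f u) = true → u = s ∧ v = t) :
    R (f s) (f t) s t := by
  obtain ⟨u, v, h1, h2, h3, h4⟩ := hn f (fun u v h => hf.1 u v h) hf.2.1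
  rcases lt_or_gt_of_ne h1 with h | h
  · obtain ⟨rfl, rfl⟩ := hf.2.2 u v h h2 h3
    exact h4
  · obtain ⟨rfl, rfl⟩ := hf.2.2 v u h h3 h2
    exact hs _ _ _ _ h4

/-- The value of a double-conflict assignment. -/
theorem double_conflict (M : Fin 4 → Fin 7 → Bool) (R : Fin 7 → Fin 7 → Fin 4 → Fin 4 → Prop)
    (hs : ∀ α β u v, R α β u v → R β α v u)
    (hn : ∀ f : Fin 4 → Fin 7, Function.Injective f → (∀ u, M u (f u) = false) →
      ∃ u v, u ≠ v ∧ M u (f v) = true ∧ M v (f u) = true ∧ R (f u) (f v) u v)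
    (f : Fin 4 → Fin 7) (s t s' t' : Fin 4)
    (hf : (∀ u v, f u = f v → u = v) ∧ (∀ u, M u (f u) = false) ∧
      ∀ u v, u < v → M u (f v) = true → M v (f u) = true → (u = s ∧ v = t) ∨ (u = s' ∧ v = t')) :
    R (f s) (f t) s t ∨ R (f s') (f t') s' t' := by
  obtain ⟨u, v, h1, h2, h3, h4⟩ := hn f (fun u v h => hf.1 u v h) hf.2.1
  rcases lt_or_gt_of_ne h1 with h | h
  · obtain ⟨rfl, rfl⟩ | ⟨rfl, rfl⟩ := hf.2.2 u v h h2 h3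
    · exact Or.inl h4
    · exact Or.inr h4
  · obtain ⟨rfl, rfl⟩ | ⟨rfl, rfl⟩ := hf.2.2 v u h h3 h2
    · exact Or.inl (hs _ _ _ _ h4)
    · exact Or.inr (hs _ _ _ _ h4)

theorem P_three : P (toM [1, 1, 1, 6, 10, 12, 14]) := by
  intro R hs hu hn
  have h1 := unit_conflict _ R hs hn ![3, 0, 4, 1] 0 1 (by decide)
  have h2 := unit_conflict _ R hs hn ![3, 5, 0, 1] 0 2 (by decide)
  exact absurd (hu _ _ _ _ _ (hs _ _ _ _ h1) (hs _ _ _ _ h2)) (by decide)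

theorem P_four : P (toM [1, 1, 3, 6, 10, 12, 12]) := by
  intro R hs hu hn
  have h1 := unit_conflict _ R hs hn ![3, 0, 4, 1] 0 1 (by decide)
  have h2 := unit_conflict _ R hs hn ![3, 5, 0, 1] 0 2 (by decide)
  exact absurd (hu _ _ _ _ _ (hs _ _ _ _ h1) (hs _ _ _ _ h2)) (by decide)

theorem P_five : P (toM [1, 2, 3, 3, 12, 12, 12]) := by
  intro R hs hu hn
  have h1 := unit_conflict _ R hs hn ![1, 4, 0, 2] 1 3 (by decide)
  have h2 := unit_conflict _ R hs hn ![1, 4, 2, 0] 1 2 (by decide)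
  exact absurd (hu _ _ _ _ _ (hs _ _ _ _ h1) (hs _ _ _ _ h2)) (by decide)

theorem P_two : P (toM [0, 3, 3, 5, 10, 12, 12]) := by
  intro R hs hu hn
  have h41 : R 4 1 0 3 := unit_conflict _ R hs hn ![4, 0, 2, 1] 0 3 (by decide)
  have h42 : R 4 2 0 3 := unit_conflict _ R hs hn ![4, 0, 1, 2] 0 3 (by decide)
  have h43 : R 4 3 0 3 := unit_conflict _ R hs hn ![4, 0, 1, 3] 0 3 (by decide)
  have h51 : R 5 1 0 3 := unit_conflict _ R hs hn ![5, 0, 4, 1] 0 3 (by decide)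
  have h52 : R 5 2 0 3 := unit_conflict _ R hs hn ![5, 0, 4, 2] 0 3 (by decide)
  have h53 : R 5 3 0 3 := unit_conflict _ R hs hn ![5, 6, 0, 3] 0 3 (by decide)
  have h61 : R 6 1 0 3 := unit_conflict _ R hs hn ![6, 0, 4, 1] 0 3 (by decide)
  have h62 : R 6 2 0 3 := unit_conflict _ R hs hn ![6, 0, 4, 2] 0 3 (by decide)
  have h63 : R 6 3 0 3 := unit_conflict _ R hs hn ![6, 5, 0, 3] 0 3 (by decide)
  refine ⟨0, 3, 0, by decide, by decide, ?_, by decide, by decide⟩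
  have hi : ∀ i, toM [0, 3, 3, 5, 10, 12, 12] 0 i = true → i = 1 ∨ i = 2 ∨ i = 3 := by decide
  have hj : ∀ j, toM [0, 3, 3, 5, 10, 12, 12] 3 j = true → j = 4 ∨ j = 5 ∨ j = 6 := by decide
  intro i j h h'
  rcases hi i h with rfl | rfl | rfl <;> rcases hj j h' with rfl | rfl | rfl <;> assumption

theorem P_one : P (toM [0, 3, 3, 3, 12, 12, 12]) := by
  intro R hs hu hn
  have hu' : ∀ α β u v v', R α β u v → R α β u v' → v = v' := fun α β u v v' h h' =>
    hu _ _ _ _ _ (hs _ _ _ _ h) (hs _ _ _ _ h')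
  -- color 0 at vertex 1, at vertex 2, at vertex 3
  have hA : ∀ p q q' : Fin 7, 4 ≤ p → 1 ≤ q → q ≤ 3 → 1 ≤ q' → q' ≤ 3 → q ≠ q' →
      R p q 0 2 ∨ R p q' 0 3 := by
    intro p q q' h1 h2 h3 h4 h5 h6
    exact double_conflict _ R hs hn ![p, 0, q, q'] 0 2 0 3 (by revert p q q'; decide +kernel)
  have hC : ∀ p p' q : Fin 7, 4 ≤ p → 4 ≤ p' → p ≠ p' → 1 ≤ q → q ≤ 3 →
      R p q 0 2 ∨ R p' q 1 2 := by
    intro p p' q h1 h2 h3 h4 h5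
    exact double_conflict _ R hs hn ![p, p', q, 0] 0 2 1 2 (by revert p p' q; decide +kernel)
  have hD : ∀ p p' q : Fin 7, 4 ≤ p → 4 ≤ p' → p ≠ p' → 1 ≤ q → q ≤ 3 →
      R p q 0 3 ∨ R p' q 1 3 := by
    intro p p' q h1 h2 h3 h4 h5
    exact double_conflict _ R hs hn ![p, p', 0, q] 0 3 1 3 (by revert p p' q; decide +kernel)
  have hi : ∀ i, toM [0, 3, 3, 3, 12, 12, 12] 0 i = true → 1 ≤ i ∧ i ≤ 3 := by decide
  have hj2 : ∀ j, toM [0, 3, 3, 3, 12, 12, 12] 2 j = true → 4 ≤ j := by decide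
  have hj3 : ∀ j, toM [0, 3, 3, 3, 12, 12, 12] 3 j = true → 4 ≤ j := by decide
  rcases hA 4 1 2 (by decide) (by decide) (by decide) (by decide) (by decide) (by decide) with h | h
  · have step1 : ∀ p : Fin 7, 4 ≤ p → R p 1 0 2 := by
      intro p hp
      by_cases h4 : p = 4
      · rw [h4]; exact h
      · rcases hC p 4 1 hp (by decide) h4 (by decide) (by decide) with h' | h'
        · exact h'
        · exact absurd (hu _ _ _ _ _ h h') (by decide)
    have step2 : ∀ p q : Fin 7, 4 ≤ p → 1 ≤ q → q ≤ 3 → R p q 0 2 := by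
      intro p q hp h1 h3
      by_cases h4 : q = 1
      · rw [h4]; exact step1 p hp
      · rcases hA p q 1 hp h1 h3 (by decide) (by decide) h4 with h' | h'
        · exact h'
        · exact absurd (hu' _ _ _ _ _ (step1 p hp) h') (by decide)
    exact ⟨0, 2, 0, by decide, by decide,
      fun i j h h' => step2 j i (hj2 j h') (hi i h).1 (hi i h).2, by decide, by decide⟩
  · have step1 : ∀ p : Fin 7, 4 ≤ p → R p 2 0 3 := by
      intro p hp
      by_cases h4 : p = 4
      · rw [h4]; exact h
      · rcases hD p 4 2 hp (by decide) h4 (by decide) (by decide) with h' | h'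
        · exact h'
        · exact absurd (hu _ _ _ _ _ h h') (by decide)
    have step2 : ∀ p q : Fin 7, 4 ≤ p → 1 ≤ q → q ≤ 3 → R p q 0 3 := by
      intro p q hp h1 h3
      by_cases h4 : q = 2
      · rw [h4]; exact step1 p hp
      · rcases hA p 2 q hp (by decide) (by decide) h1 h3 (Ne.symm h4) with h' | h'
        · exact absurd (hu' _ _ _ _ _ (step1 p hp) h') (by decide)
        · exact h'
    exact ⟨0, 3, 0, by decide, by decide,
      fun i j h h' => step2 j i (hj3 j h') (hi i h).1 (hi i h).2, by decide, by decide⟩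


/-- The masks of the five exceptional configurations. -/
def canon : List (List ℕ) :=
  [[0, 3, 3, 3, 12, 12, 12], [0, 3, 3, 5, 10, 12, 12], [1, 1, 1, 6, 10, 12, 14],
   [1, 1, 3, 6, 10, 12, 12], [1, 2, 3, 3, 12, 12, 12]]

theorem P_canon (l : List ℕ) (h : l ∈ canon) : P (toM l) := by
  simp only [canon, List.mem_cons, List.not_mem_nil, or_false] at h
  rcases h with rfl | rfl | rfl | rfl | rfl
  · exact P_one
  · exact P_two
  · exact P_three
  · exact P_four
  · exact P_five

/-- Search for a conflict-free assignment. -/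
def goodL (l : List ℕ) : Bool :=
  [0, 1, 2, 3, 4, 5, 6].any fun p =>
    let a := l.getD p 0
    !a.testBit 0 && [0, 1, 2, 3, 4, 5, 6].any fun q =>
      let b := l.getD q 0
      p != q && !b.testBit 1 && !(a.testBit 1 && b.testBit 0) && [0, 1, 2, 3, 4, 5, 6].any fun r =>
        let c := l.getD r 0
        p != r && q != r && !c.testBit 2 && !(a.testBit 2 && c.testBit 0) &&
          !(b.testBit 2 && c.testBit 1) && [0, 1, 2, 3, 4, 5, 6].any fun s =>
            let d := l.getD s 0
            p != s && q != s && r != s && !d.testBit 3 && !(a.testBit 3 && d.testBit 0) &&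
              !(b.testBit 3 && d.testBit 1) && !(c.testBit 3 && d.testBit 2)

theorem P_goodL (l : List ℕ) (h : goodL l = true) : P (toM l) := by
  simp only [goodL, List.any_eq_true, Bool.and_eq_true, bne_iff_ne, Bool.not_eq_true',
    Bool.and_eq_false_iff] at h
  obtain ⟨p, hp, ha, q, hq, ⟨⟨h1, hb⟩, h2⟩, r, hr, ⟨⟨⟨⟨h3, h4⟩, hc⟩, h5⟩, h6⟩, s, hs,
    ⟨⟨⟨⟨⟨h7, h8⟩, h9⟩, hd⟩, h10⟩, h11⟩, h12⟩ := h
  have lt7 : ∀ z ∈ [0, 1, 2, 3, 4, 5, 6], z < 7 := by decide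
  refine P_good _ ![⟨p, lt7 p hp⟩, ⟨q, lt7 q hq⟩, ⟨r, lt7 r hr⟩, ⟨s, lt7 s hs⟩] ?_ ?_ ?_
  · intro u v huv
    fin_cases u <;> fin_cases v <;> simp_all [Fin.ext_iff]
  · intro u
    fin_cases u
    exacts [ha, hb, hc, hd]
  · have key : ∀ b b' : Bool, (b = false ∨ b' = false) → ¬ (b' = true ∧ b = true) := by decide
    intro u v huv
    fin_cases u <;> fin_cases v <;> first | exact absurd huv (by decide) | skip
    exacts [key _ _ h2, key _ _ h5, key _ _ h10, key _ _ h6, key _ _ h11, key _ _ h12]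

/-- Permute the bits of a mask. -/
def permMask (s : Fin 4 → Fin 4) (m : ℕ) : ℕ :=
  (m.testBit (s 0)).toNat + 2 * (m.testBit (s 1)).toNat + 4 * (m.testBit (s 2)).toNat +
    8 * (m.testBit (s 3)).toNat

theorem permMask_testBit (s : Fin 4 → Fin 4) (m : ℕ) (u : Fin 4) :
    (permMask s m).testBit u = m.testBit (s u) := by
  unfold permMask
  generalize h0 : m.testBit (s 0) = b0
  generalize h1 : m.testBit (s 1) = b1
  generalize h2 : m.testBit (s 2) = b2
  generalize h3 : m.testBit (s 3) = b3
  fin_cases u <;> simp only [Fin.zero_eta, Fin.mk_one, Fin.reduceFinMk, h0, h1, h2, h3] <;>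
    clear h0 h1 h2 h3 <;> revert b0 b1 b2 b3 <;> decide

def perms4 : List (Fin 4 → Fin 4) :=
  [![0, 1, 2, 3], ![0, 1, 3, 2], ![0, 2, 1, 3], ![0, 2, 3, 1], ![0, 3, 1, 2], ![0, 3, 2, 1],
   ![1, 0, 2, 3], ![1, 0, 3, 2], ![1, 2, 0, 3], ![1, 2, 3, 0], ![1, 3, 0, 2], ![1, 3, 2, 0],
   ![2, 0, 1, 3], ![2, 0, 3, 1], ![2, 1, 0, 3], ![2, 1, 3, 0], ![2, 3, 0, 1], ![2, 3, 1, 0],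
   ![3, 0, 1, 2], ![3, 0, 2, 1], ![3, 1, 0, 2], ![3, 1, 2, 0], ![3, 2, 0, 1], ![3, 2, 1, 0]]

theorem perms4_inj : ∀ s ∈ perms4, Function.Injective s := by decide +kernel

def badL (l : List ℕ) : Bool :=
  perms4.any fun s => canon.contains ((l.map (permMask s)).insertionSort (· ≤ ·))

def cntL (u : ℕ) (l : List ℕ) : ℕ := l.countP (fun m => m.testBit u)

/-- Masks, their packed bits in base 8, and the packed counts that have to be complete once all
later masks are at most this one. -/
def tbl : List (ℕ × ℕ × ℕ) :=
  [(0, 0, 1755), (1, 1, 1752), (2, 8, 1728), (3, 9, 1728), (4, 64, 1536), (5, 65, 1536),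
   (6, 72, 1536), (7, 73, 1536), (8, 512, 0), (9, 513, 0), (10, 520, 0), (11, 521, 0),
   (12, 576, 0), (13, 577, 0), (14, 584, 0), (15, 585, 0)]

def okc (c r : ℕ) : Bool := Nat.beq (Nat.land c 2340) 0 && Nat.beq (Nat.land c r) r

/-- Enumeration of the sorted lists of seven masks in which every bit occurs three times. -/
def chk : ℕ → ℕ → ℕ → List ℕ → Bool
  | 0, _, c, acc => !(Nat.beq c 1755) || (goodL acc || badL acc)
  | n + 1, hi, c, acc => tbl.all fun t =>
      Nat.blt hi t.1 || (!(okc (c + t.2.1) t.2.2) || chk n t.1 (c + t.2.1) (t.1 :: acc))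

set_option maxRecDepth 100000 in
theorem chk_true : chk 7 15 0 [] = true := by decide +kernel

def pack (l : List ℕ) : ℕ := cntL 0 l + 8 * cntL 1 l + 64 * cntL 2 l + 512 * cntL 3 l

theorem tbl_mem : ∀ m : Fin 16, ∃ t ∈ tbl, t.1 = m.val ∧ t.2.1 = pack [m.val] ∧
    ∀ a b c d : Fin 4, ((m.val < 1 → a = 3) ∧ (m.val < 2 → b = 3) ∧ (m.val < 4 → c = 3) ∧
      (m.val < 8 → d = 3)) → okc (a.val + 8 * b.val + 64 * c.val + 512 * d.val) t.2.2 = true := by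
  decide +kernel

theorem cntL_append (u : ℕ) (l l' : List ℕ) : cntL u (l ++ l') = cntL u l + cntL u l' := by
  simp [cntL]

theorem cntL_zero (u m : ℕ) (l : List ℕ) (h : ∀ x ∈ l, x ≤ m) (hm : m < 2 ^ u) : cntL u l = 0 := by
  rw [cntL, List.countP_eq_zero]
  intro x hx
  simp [Nat.testBit_lt_two_pow (lt_of_le_of_lt (h x hx) hm)]

theorem chk_sound (n : ℕ) : ∀ (hi : ℕ) (acc l : List ℕ), chk n hi (pack acc) acc = true →
    l.length = n → (∀ m ∈ l, m < 16) → (hi :: l).Pairwise (· ≥ ·) →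
    (∀ u < 4, cntL u (l.reverse ++ acc) = 3) →
    goodL (l.reverse ++ acc) = true ∨ badL (l.reverse ++ acc) = true := by
  induction n with
  | zero =>
    intro hi acc l h hl _ _ hc
    obtain rfl := List.length_eq_zero_iff.mp hl
    simp only [List.reverse_nil, List.nil_append] at hc ⊢
    simpa [chk, pack, hc 0 (by omega), hc 1 (by omega), hc 2 (by omega), hc 3 (by omega)] using h
  | succ n ih =>
    intro hi acc l h hl h16 hs hc
    match l, hl with
    | m :: l, hl =>
      have hr : (m :: l).reverse ++ acc = l.reverse ++ (m :: acc) := by simp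
      rw [hr] at hc ⊢
      simp only [chk, List.all_eq_true] at h
      obtain ⟨t, ht, ht1, ht2, ht3⟩ := tbl_mem ⟨m, h16 m (by simp)⟩
      simp only at ht1 ht2 ht3
      subst ht1
      have hm := h t ht
      have hhi : t.1 ≤ hi := (List.pairwise_cons.mp hs).1 t.1 (by simp)
      have hs' := (List.pairwise_cons.mp hs).2
      have hle : ∀ x ∈ l.reverse, x ≤ t.1 := by
        intro x hx
        exact (List.pairwise_cons.mp hs').1 x (by simpa using hx)
      have hpack : pack acc + t.2.1 = pack (t.1 :: acc) := by
        rw [ht2, show t.1 :: acc = [t.1] ++ acc from rfl]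
        simp only [pack, cntL_append]
        ring
      have hle3 : ∀ u < 4, cntL u (t.1 :: acc) ≤ 3 := by
        intro u hu
        have := hc u hu
        rw [cntL_append] at this
        omega
      have heq3 : ∀ u < 4, t.1 < 2 ^ u → cntL u (t.1 :: acc) = 3 := by
        intro u hu hlt
        have := hc u hu
        rwa [cntL_append, cntL_zero u t.1 _ hle hlt, zero_add] at this
      have hok : okc (pack acc + t.2.1) t.2.2 = true := by
        rw [hpack]
        exact ht3 ⟨_, Nat.lt_succ_of_le (hle3 0 (by omega))⟩
          ⟨_, Nat.lt_succ_of_le (hle3 1 (by omega))⟩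
          ⟨_, Nat.lt_succ_of_le (hle3 2 (by omega))⟩ ⟨_, Nat.lt_succ_of_le (hle3 3 (by omega))⟩
          ⟨fun h => Fin.ext (heq3 0 (by omega) (by omega)),
          fun h => Fin.ext (heq3 1 (by omega) (by omega)),
          fun h => Fin.ext (heq3 2 (by omega) (by omega)),
          fun h => Fin.ext (heq3 3 (by omega) (by omega))⟩
      have hblt : Nat.blt hi t.1 = false := by
        rw [Bool.eq_false_iff]
        intro h'
        have := Nat.blt_eq.mp h'
        omega
      rw [hok, hblt, hpack] at hm
      exact ih t.1 (t.1 :: acc) l (by simpa using hm) (by simpa using hl)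
        (fun x hx => h16 x (by simp [hx])) hs' hc

/-- The mask of a color. -/
def maskOf (M : Fin 4 → Fin 7 → Bool) (γ : Fin 7) : ℕ :=
  (M 0 γ).toNat + 2 * (M 1 γ).toNat + 4 * (M 2 γ).toNat + 8 * (M 3 γ).toNat

theorem maskOf_testBit (M : Fin 4 → Fin 7 → Bool) (γ : Fin 7) (u : Fin 4) :
    (maskOf M γ).testBit u = M u γ := by
  unfold maskOf
  generalize h0 : M 0 γ = b0
  generalize h1 : M 1 γ = b1
  generalize h2 : M 2 γ = b2
  generalize h3 : M 3 γ = b3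
  fin_cases u <;> simp only [Fin.zero_eta, Fin.mk_one, Fin.reduceFinMk, h0, h1, h2, h3] <;>
    clear h0 h1 h2 h3 <;> revert b0 b1 b2 b3 <;> decide

theorem maskOf_lt (M : Fin 4 → Fin 7 → Bool) (γ : Fin 7) : maskOf M γ < 16 := by
  unfold maskOf
  generalize M 0 γ = b0
  generalize M 1 γ = b1
  generalize M 2 γ = b2
  generalize M 3 γ = b3
  revert b0 b1 b2 b3; decide

theorem toM_ofFn (t : Fin 7 → ℕ) (u : Fin 4) (γ : Fin 7) :
    toM (List.ofFn t) u γ = (t γ).testBit u := by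
  rw [toM, List.getD_eq_getElem _ _ (by simp), List.getElem_ofFn]

/-- Sorting the colors. -/
theorem exists_sorted (t : Fin 7 → ℕ) : ∃ τ : Equiv.Perm (Fin 7),
    List.ofFn (t ∘ τ) = (List.ofFn t).insertionSort (· ≤ ·) := by
  refine ⟨Tuple.sort t, ?_⟩
  apply List.Perm.eq_of_pairwise (le := (· ≤ ·))
  · intro a b _ _ h1 h2; exact le_antisymm h1 h2
  · exact (List.sortedLE_ofFn_iff.mpr (Tuple.monotone_sort t)).pairwise
  · exact List.pairwise_insertionSort _ _
  · exact (Equiv.Perm.ofFn_comp_perm _ _).trans (List.perm_insertionSort _ _).symm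

theorem P_of_sorted (M : Fin 4 → Fin 7 → Bool)
    (h : P (toM ((List.ofFn (maskOf M)).insertionSort (· ≤ ·)))) : P M := by
  obtain ⟨τ, hτ⟩ := exists_sorted (maskOf M)
  rw [← hτ] at h
  apply P_perm M 1 τ
  convert h using 1
  funext u γ
  rw [toM_ofFn]
  simp [maskOf_testBit]

theorem core (M : Fin 4 → Fin 7 → Bool)
    (hM : ∀ u, (Finset.univ.filter (fun γ => M u γ = true)).card = 3) : P M := by
  apply P_of_sorted
  obtain ⟨τ, hτ⟩ := exists_sorted (maskOf M)
  set l := (List.ofFn (maskOf M)).insertionSort (· ≤ ·) with hl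
  have hperm : l.Perm (List.ofFn (maskOf M)) := List.perm_insertionSort _ _
  have hlen : l.length = 7 := by rw [hperm.length_eq]; simp
  have h16 : ∀ m ∈ l, m < 16 := by
    intro m hm
    rw [hperm.mem_iff, List.mem_ofFn] at hm
    obtain ⟨γ, rfl⟩ := hm
    exact maskOf_lt M γ
  have hsort : (15 :: l.reverse).Pairwise (· ≥ ·) := by
    rw [List.pairwise_cons, List.pairwise_reverse]
    refine ⟨fun m hm => ?_, List.pairwise_insertionSort _ _⟩
    have := h16 m (by simpa using hm)
    omega
  have hcnt : ∀ u < 4, cntL u (l.reverse.reverse ++ []) = 3 := by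
    intro u hu
    have := hM ⟨u, hu⟩
    rw [List.append_nil, List.reverse_reverse, cntL, hperm.countP_eq, ← this]
    have e : (fun γ => M ⟨u, hu⟩ γ = true) = fun γ => (maskOf M γ).testBit u = true := by
      funext γ
      rw [← maskOf_testBit M γ ⟨u, hu⟩]
    simp only [e]
    rw [Finset.card_filter, Fin.sum_univ_seven]
    simp only [List.ofFn_succ, List.ofFn_zero, List.countP_cons, List.countP_nil]
    simp
    omega
  have hres := chk_sound 7 15 [] l.reverse chk_true (by simpa using hlen)
    (fun m hm => h16 m (by simpa using hm)) hsort hcnt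
  rw [List.append_nil, List.reverse_reverse] at hres
  rcases hres with h | h
  · exact P_goodL _ h
  · simp only [badL, List.any_eq_true, List.contains_iff_mem] at h
    obtain ⟨s, hs, hc⟩ := h
    have hbij : Function.Bijective s := Finite.injective_iff_bijective.mp (perms4_inj s hs)
    apply P_perm _ (Equiv.ofBijective s hbij) 1
    apply P_of_sorted
    have : List.ofFn (maskOf fun u γ => toM l ((Equiv.ofBijective s hbij) u)
        ((1 : Equiv.Perm (Fin 7)) γ)) = l.map (permMask s) := by
      rw [← hτ, List.map_ofFn]
      congr 1
      funext γ
      simp only [maskOf, permMask, toM_ofFn, Equiv.ofBijective_apply, Equiv.Perm.one_apply,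
        Function.comp]
    rw [this]
    exact P_canon _ hc

/-! ### Graph part -/

/-- The subgraph of edges coloured `α` or `β`. -/
def B {V : Type*} (H : SimpleGraph V) (c : Sym2 V → Fin 7) (α β : Fin 7) : SimpleGraph V where
  Adj x y := H.Adj x y ∧ (c s(x, y) = α ∨ c s(x, y) = β)
  symm := ⟨fun x y h => ⟨h.1.symm, by rw [Sym2.eq_swap]; exact h.2⟩⟩
  loopless := ⟨fun x h => H.loopless.irrefl x h.1⟩

theorem B_adj {V : Type*} {H : SimpleGraph V} {c : Sym2 V → Fin 7} {α β : Fin 7} {x y : V} :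
    (B H c α β).Adj x y ↔ H.Adj x y ∧ (c s(x, y) = α ∨ c s(x, y) = β) := Iff.rfl

theorem B_swap {V : Type*} (H : SimpleGraph V) (c : Sym2 V → Fin 7) (α β : Fin 7) :
    B H c α β = B H c β α := by
  ext x y
  simp only [B_adj, or_comm]

def Prp {V : Type*} (H : SimpleGraph V) (c : Sym2 V → Fin 7) : Prop :=
  ∀ u x y, H.Adj u x → H.Adj u y → c s(u, x) = c s(u, y) → x = y

def Good {V : Type*} (H : SimpleGraph V) (c : Sym2 V → Fin 7) : Prop :=
  Prp H c ∧ ∀ α β, (B H c α β).IsAcyclic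

theorem isolated_reach {V : Type*} {H : SimpleGraph V} {v w : V} (hv : ∀ x, ¬ H.Adj v x)
    (h : H.Reachable v w) : v = w := by
  obtain ⟨p⟩ := h
  cases p with
  | nil => rfl
  | cons h _ => exact absurd h (hv _)

theorem leaf_aux {V : Type*} {H : SimpleGraph V}
    (hdeg : ∀ x a b c, H.Adj x a → H.Adj x b → H.Adj x c → a = b ∨ a = c ∨ b = c)
    {a b : V} (p : H.Walk a b) : p.IsPath → ∀ (z c : V) (q : H.Walk a c), q.IsPath → H.Adj z a →
    z ∉ p.support → z ∉ q.support → (∀ y y', H.Adj b y → H.Adj b y' → y = y') →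
    (∀ y y', H.Adj c y → H.Adj c y' → y = y') → b = c := by
  induction p with
  | nil =>
    intro _ z c q _ hz _ hzq hb _
    cases q with
    | nil => rfl
    | cons h q' =>
      have := hb _ _ hz.symm h
      subst this
      simp at hzq
  | cons h p' ih =>
    intro hp z c q hq hz hzp hzq hb hc
    cases q with
    | nil =>
      have := hc _ _ hz.symm h
      subst this
      simp at hzp
    | cons h' q' =>
      rcases hdeg _ _ _ _ hz.symm h h' with h1 | h1 | h1
      · subst h1; simp at hzp
      · subst h1; simp at hzq
      · subst h1
        rw [SimpleGraph.Walk.cons_isPath_iff] at hp hq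
        exact ih hp.1 _ _ q' hq.1 h hp.2 hq.2 hb hc

theorem leaf_unique {V : Type*} {H : SimpleGraph V}
    (hdeg : ∀ x a b c, H.Adj x a → H.Adj x b → H.Adj x c → a = b ∨ a = c ∨ b = c)
    {a b c : V} (ha : ∀ y y', H.Adj a y → H.Adj a y' → y = y')
    (hb : ∀ y y', H.Adj b y → H.Adj b y' → y = y')
    (hc : ∀ y y', H.Adj c y → H.Adj c y' → y = y') (hab : a ≠ b) (hac : a ≠ c)
    (rb : H.Reachable a b) (rc : H.Reachable a c) : b = c := by
  obtain ⟨p, hp⟩ := rb.exists_isPath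
  obtain ⟨q, hq⟩ := rc.exists_isPath
  cases p with
  | nil => exact absurd rfl hab
  | cons h p' =>
    cases q with
    | nil => exact absurd rfl hac
    | cons h' q' =>
      have := ha _ _ h h'
      subst this
      rw [SimpleGraph.Walk.cons_isPath_iff] at hp hq
      exact leaf_aux hdeg p' hp.1 _ _ q' hq.1 h hp.2 hq.2 hb hc

theorem sup_edge_reach {V : Type*} {H : SimpleGraph V} {v u w : V} (hv : ∀ x, ¬ H.Adj v x)
    (h : (H ⊔ SimpleGraph.edge v u).Reachable v w) : w = v ∨ H.Reachable u w := by
  have key : ∀ x y, (H ⊔ SimpleGraph.edge v u).Walk x y → (x = v ∨ H.Reachable u x) →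
      (y = v ∨ H.Reachable u y) := by
    intro x y p
    induction p with
    | nil => exact id
    | cons h0 p' ih =>
      intro hx
      apply ih
      rw [SimpleGraph.sup_adj, SimpleGraph.edge_adj] at h0
      rcases h0 with h | ⟨h, _⟩
      · rcases hx with hx | hx
        · rw [hx] at h
          exact absurd h (hv _)
        · exact Or.inr (hx.trans h.reachable)
      · rcases h with ⟨_, h⟩ | ⟨_, h⟩
        · right; rw [h]
        · left; exact h
  obtain ⟨p⟩ := h
  exact key _ _ p (Or.inl rfl)

theorem B_deg {V : Type*} {H : SimpleGraph V} {c : Sym2 V → Fin 7} (hp : Prp H c) (α β : Fin 7) :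
    ∀ x a b d, (B H c α β).Adj x a → (B H c α β).Adj x b → (B H c α β).Adj x d →
      a = b ∨ a = d ∨ b = d := by
  rintro x a b d ⟨h1, h1'⟩ ⟨h2, h2'⟩ ⟨h3, h3'⟩
  have h12 := hp x a b h1 h2
  have h13 := hp x a d h1 h3
  have h23 := hp x b d h2 h3
  grind

theorem B_leaf {V : Type*} {H : SimpleGraph V} {c : Sym2 V → Fin 7} (hp : Prp H c) {α β : Fin 7}
    {u : V} (hu : ∀ x, H.Adj u x → c s(u, x) ≠ α) :
    ∀ y y', (B H c α β).Adj u y → (B H c α β).Adj u y' → y = y' := by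
  rintro y y' ⟨h1, h1'⟩ ⟨h2, h2'⟩
  have := hu _ h1
  have := hu _ h2
  apply hp u y y' h1 h2
  grind

theorem first_edge {V : Type*} {H : SimpleGraph V} {u w : V} (h : H.Reachable u w) (hne : u ≠ w) :
    ∃ x, H.Adj u x := by
  obtain ⟨p⟩ := h
  cases p with
  | nil => exact absurd rfl hne
  | cons h _ => exact ⟨_, h⟩

theorem second_edge {V : Type*} {H : SimpleGraph V} {c : Sym2 V → Fin 7} (hp : Prp H c)
    {i j : Fin 7} {u w : V} (h : (B H c j i).Reachable u w) (hne : u ≠ w)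
    (hu : ∀ x, H.Adj u x → c s(u, x) ≠ j) (hw : ∀ x, H.Adj w x → c s(w, x) ≠ i) :
    ∃ x, H.Adj u x ∧ c s(u, x) = i ∧ ∃ y, H.Adj x y ∧ c s(x, y) = j := by
  obtain ⟨p, hpp⟩ := h.exists_isPath
  cases p with
  | nil => exact absurd rfl hne
  | @cons _ x _ h p' =>
    have hi : c s(u, x) = i := by
      have := hu _ h.1
      have := h.2
      tauto
    refine ⟨x, h.1, hi, ?_⟩
    rw [SimpleGraph.Walk.cons_isPath_iff] at hpp
    cases p' with
    | nil => exact absurd (by rw [Sym2.eq_swap]; exact hi) (hw _ h.1.symm)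
    | @cons _ y _ h2 p2 =>
      refine ⟨y, h2.1, ?_⟩
      rcases h2.2 with h3 | h3
      · exact h3
      · exfalso
        have := hp x u y h.1.symm h2.1 (by rw [h3, Sym2.eq_swap, hi])
        subst this
        simp at hpp

/-- The critical-path relation. -/
def RR {V : Type*} (K H : SimpleGraph V) (v : V) (c : Sym2 V → Fin 7) (g : V → Fin 4)
    (T : Fin 4 → Finset (Fin 7)) (α β : Fin 7) (k l : Fin 4) : Prop :=
  α ∉ T k ∧ β ∉ T l ∧ ∃ u w, K.Adj v u ∧ K.Adj v w ∧ u ≠ w ∧ g u = k ∧ g w = l ∧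
    (B H c α β).Reachable u w

theorem exists_star {V : Type*} (v : V) (c : Sym2 V → Fin 7) (f : V → Fin 7) :
    ∃ c' : Sym2 V → Fin 7, (∀ u, u ≠ v → c' s(v, u) = f u) ∧
      ∀ x y, x ≠ v → y ≠ v → c' s(x, y) = c s(x, y) := by
  classical
  refine ⟨fun e => if h : v ∈ e then f (Sym2.Mem.other h) else c e, ?_, ?_⟩
  · intro u hu
    have h : v ∈ s(v, u) := by simp
    have h2 := Sym2.other_spec h
    rw [Sym2.congr_right] at h2
    simp only [h, dif_pos, h2]
  · intro x y hx hy
    have : v ∉ s(x, y) := by simp [hx.symm, hy.symm]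
    simp [this]

theorem good_ext {V : Type*} {K H : SimpleGraph V} {v : V}
    (hHK : ∀ x y, H.Adj x y ↔ K.Adj x y ∧ x ≠ v ∧ y ≠ v) {c : Sym2 V → Fin 7} (hc : Good H c)
    (f : V → Fin 7) (hf : ∀ u w, K.Adj v u → K.Adj v w → f u = f w → u = w)
    (hS : ∀ u, K.Adj v u → ∀ x, H.Adj u x → c s(u, x) ≠ f u)
    (hR : ∀ u w, K.Adj v u → K.Adj v w → u ≠ w → ¬ (B H c (f u) (f w)).Reachable u w) :
    ∃ c', Good K c' := by
  classical
  obtain ⟨c', h1, h2⟩ := exists_star v c f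
  have h1' : ∀ u, K.Adj v u → c' s(v, u) = f u := fun u hu => h1 u hu.ne.symm
  refine ⟨c', ?_, ?_⟩
  · intro u x y hx hy hxy
    by_cases hu : u = v
    · subst hu
      rw [h1' _ hx, h1' _ hy] at hxy
      exact hf _ _ hx hy hxy
    · by_cases hxv : x = v
      · by_cases hyv : y = v
        · rw [hxv, hyv]
        · subst hxv
          rw [h2 u y hu hyv, Sym2.eq_swap, h1' _ hx.symm] at hxy
          exact absurd hxy.symm (hS u hx.symm y ((hHK _ _).2 ⟨hy, hu, hyv⟩))
      · by_cases hyv : y = v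
        · subst hyv
          rw [h2 u x hu hxv, Sym2.eq_swap (a := u) (b := y), h1' _ hy.symm] at hxy
          exact absurd hxy (hS u hy.symm x ((hHK _ _).2 ⟨hx, hu, hxv⟩))
        · rw [h2 u x hu hxv, h2 u y hu hyv] at hxy
          exact hc.1 u x y ((hHK _ _).2 ⟨hx, hu, hxv⟩) ((hHK _ _).2 ⟨hy, hu, hyv⟩) hxy
  · intro α β
    have hiso : ∀ x, ¬ (B H c α β).Adj v x := by
      intro x hx
      exact ((hHK _ _).1 hx.1).2.1 rfl
    have pick : ∀ γ, ∃ u0, (u0 = v ∨ (K.Adj v u0 ∧ f u0 = γ)) ∧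
        ∀ u, K.Adj v u → f u = γ → u = u0 := by
      intro γ
      by_cases h : ∃ u, K.Adj v u ∧ f u = γ
      · obtain ⟨u, hu, huγ⟩ := h
        exact ⟨u, Or.inr ⟨hu, huγ⟩, fun w hw hwγ => hf _ _ hw hu (hwγ.trans huγ.symm)⟩
      · exact ⟨v, Or.inl rfl, fun u hu huγ => absurd ⟨u, hu, huγ⟩ h⟩
    obtain ⟨u0, hu0, hu0'⟩ := pick α
    obtain ⟨w0, hw0, hw0'⟩ := pick β
    have hle : B K c' α β ≤ (B H c α β ⊔ SimpleGraph.edge v u0) ⊔ SimpleGraph.edge v w0 := by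
      have aux : ∀ y, K.Adj v y → (c' s(v, y) = α ∨ c' s(v, y) = β) → (y = u0 ∨ y = w0) := by
        intro y hy hcy
        rw [h1' y hy] at hcy
        exact hcy.imp (hu0' y hy) (hw0' y hy)
      intro x y hxy
      simp only [SimpleGraph.sup_adj, SimpleGraph.edge_adj]
      have hne := hxy.1.ne
      by_cases hx : x = v
      · subst hx
        rcases aux y hxy.1 hxy.2 with h | h
        · exact Or.inl (Or.inr ⟨Or.inl ⟨rfl, h⟩, hne⟩)
        · exact Or.inr ⟨Or.inl ⟨rfl, h⟩, hne⟩
      · by_cases hy : y = v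
        · subst hy
          rcases aux x hxy.1.symm (by rw [Sym2.eq_swap]; exact hxy.2) with h | h
          · exact Or.inl (Or.inr ⟨Or.inr ⟨h, rfl⟩, hne⟩)
          · exact Or.inr ⟨Or.inr ⟨h, rfl⟩, hne⟩
        · refine Or.inl (Or.inl ⟨(hHK _ _).2 ⟨hxy.1, hx, hy⟩, ?_⟩)
          rw [← h2 x y hx hy]
          exact hxy.2
    refine SimpleGraph.IsAcyclic.anti hle ?_
    rw [SimpleGraph.isAcyclic_sup_fromEdgeSet_iff, SimpleGraph.isAcyclic_sup_fromEdgeSet_iff]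
    refine ⟨⟨hc.2 α β, fun h => Or.inl (isolated_reach hiso h)⟩, fun h => ?_⟩
    rcases sup_edge_reach hiso h with h | h
    · exact Or.inl h.symm
    · rcases hw0 with hw0 | ⟨hw0, hwβ⟩
      · exact Or.inl hw0.symm
      rcases hu0 with hu0 | ⟨hu0, huα⟩
      · rw [hu0] at h
        exact Or.inl (isolated_reach hiso h)
      by_cases huw : u0 = w0
      · right
        rw [SimpleGraph.sup_adj, SimpleGraph.edge_adj]
        exact Or.inr ⟨Or.inl ⟨rfl, huw.symm⟩, hw0.ne⟩
      · subst huα hwβ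
        exact absurd h (hR _ _ hu0 hw0 huw)

theorem ext_or {V : Type*} {K H : SimpleGraph V} {v : V}
    (hHK : ∀ x y, H.Adj x y ↔ K.Adj x y ∧ x ≠ v ∧ y ≠ v) {c : Sym2 V → Fin 7} (hc : Good H c)
    (g : V → Fin 4) (hg : ∀ u w, K.Adj v u → K.Adj v w → g u = g w → u = w)
    (T : Fin 4 → Finset (Fin 7)) (hT : ∀ k, (T k).card = 3)
    (hS : ∀ u, K.Adj v u → ∀ x, H.Adj u x → c s(u, x) ∈ T (g u)) :
    (∃ c', Good K c') ∨ Concl (fun k γ => decide (γ ∈ T k)) (RR K H v c g T) := by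
  by_cases hK : ∃ c', Good K c'
  · exact Or.inl hK
  right
  have hleaf : ∀ u γ, K.Adj v u → γ ∉ T (g u) → ∀ x, H.Adj u x → c s(u, x) ≠ γ := by
    intro u γ hu hγ x hx h
    exact hγ (h ▸ hS u hu x hx)
  refine core _ ?_ _ ?_ ?_ ?_
  · intro u
    simp only [decide_eq_true_eq]
    rw [← hT u]
    congr 1
    ext γ
    simp
  · rintro α β k l ⟨h1, h2, u, w, hu, hw, hne, hk, hl, hr⟩
    refine ⟨h2, h1, w, u, hw, hu, hne.symm, hl, hk, ?_⟩
    rw [B_swap]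
    exact hr.symm
  · rintro α β k k' l ⟨h1, h2, u, w, hu, hw, hne, hk, hl, hr⟩
      ⟨h1', _, u', w', hu', hw', hne', hk', hl', hr'⟩
    have : w' = w := hg _ _ hw' hw (hl'.trans hl.symm)
    subst this
    subst hk hk' hl
    have : u = u' := by
      refine leaf_unique (B_deg hc.1 α β) (a := w') ?_ ?_ ?_ hne.symm hne'.symm hr.symm hr'.symm
      · rw [B_swap]
        exact B_leaf hc.1 (hleaf _ _ hw h2)
      · exact B_leaf hc.1 (hleaf _ _ hu h1)
      · exact B_leaf hc.1 (hleaf _ _ hu' h1')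
    rw [this]
  · intro f hf hM
    have hM' : ∀ k, f k ∉ T k := by
      intro k
      simpa using hM k
    by_contra hcon
    apply hK
    refine good_ext hHK hc (fun u => f (g u)) (fun u w hu hw h => hg u w hu hw (hf h))
      (fun u hu => hleaf u _ hu (hM' _)) ?_
    intro u w hu hw hne hr
    apply hcon
    have half : ∀ u w, K.Adj v u → K.Adj v w → u ≠ w → 
        (B H c (f (g u)) (f (g w))).Reachable u w → f (g w) ∈ T (g u) := by
      intro u w hu hw hne hr
      obtain ⟨x, hx, hx'⟩ := first_edge hr hne
      have h3 := hleaf u _ hu (hM' (g u)) x hx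
      have h4 := hS u hu x hx
      rcases hx' with h5 | h5
      · exact absurd h5 h3
      · rwa [h5] at h4
    refine ⟨g u, g w, fun h => hne (hg u w hu hw h), ?_, ?_, hM' _, hM' _, u, w, hu, hw, hne,
      rfl, rfl, hr⟩
    · simpa using half u w hu hw hne hr
    · simpa using half w u hw hu hne.symm (by rw [B_swap]; exact hr.symm)

theorem color_card {V : Type*} [Finite V] {K : SimpleGraph V} {x : V} {n : ℕ}
    (h : (K.neighborSet x).ncard ≤ n) (c : Sym2 V → Fin 7) (s : Finset (Fin 7))
    (hs : ∀ γ ∈ s, ∃ y, K.Adj x y ∧ c s(x, y) = γ) : s.card ≤ n := by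
  classical
  refine le_trans ?_ h
  rw [← Set.ncard_coe_finset]
  have : (s : Set (Fin 7)) ⊆ (fun y => c s(x, y)) '' K.neighborSet x := by
    intro γ hγ
    obtain ⟨y, hy, hy'⟩ := hs γ hγ
    exact ⟨y, hy, hy'⟩
  exact (Set.ncard_le_ncard this (Set.toFinite _)).trans (Set.ncard_image_le (Set.toFinite _))

theorem recolor_good {V : Type*} [DecidableEq V] {H : SimpleGraph V} {c : Sym2 V → Fin 7}
    (hc : Good H c) {n x : V} (hnx : H.Adj n x) {e i : Fin 7} (hi : c s(n, x) = i)
    (hen : ∀ y, H.Adj n y → c s(n, y) ≠ e) (hex : ∀ y, H.Adj x y → c s(x, y) ≠ e)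
    (hdis : ∀ β, β ≠ i → (∀ y, H.Adj x y → c s(x, y) ≠ β) ∨ (∀ y, H.Adj n y → c s(n, y) ≠ β)) :
    Good H (Function.update c s(n, x) e) := by
  have hend : ∀ u y z, H.Adj u z → s(u, y) = s(n, x) → c s(u, z) ≠ e := by
    intro u y z hz h
    rw [Sym2.eq_iff] at h
    rcases h with ⟨rfl, rfl⟩ | ⟨rfl, rfl⟩
    · exact hen z hz
    · exact hex z hz
  constructor
  · intro u y z hy hz hyz
    by_cases h1 : s(u, y) = s(n, x)
    · by_cases h2 : s(u, z) = s(n, x)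
      · exact Sym2.congr_right.1 (h1.trans h2.symm)
      · rw [h1, Function.update_self, Function.update_of_ne h2] at hyz
        exact absurd hyz.symm (hend u y z hz h1)
    · by_cases h2 : s(u, z) = s(n, x)
      · rw [h2, Function.update_self, Function.update_of_ne h1] at hyz
        exact absurd hyz (hend u z y hy h2)
      · rw [Function.update_of_ne h2, Function.update_of_ne h1] at hyz
        exact hc.1 u y z hy hz hyz
  · have key : ∀ β, (B H (Function.update c s(n, x) e) e β).IsAcyclic := by
      intro β
      by_cases hβ : β = i
      · refine SimpleGraph.IsAcyclic.anti ?_ (hc.2 e i)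
        rintro y z ⟨hyz, h⟩
        refine ⟨hyz, ?_⟩
        by_cases h1 : s(y, z) = s(n, x)
        · rw [h1]
          exact Or.inr hi
        · rw [Function.update_of_ne h1, hβ] at h
          exact h
      · have hle : B H (Function.update c s(n, x) e) e β ≤ B H c e β ⊔ SimpleGraph.edge n x := by
          rintro y z ⟨hyz, h⟩
          rw [SimpleGraph.sup_adj, SimpleGraph.edge_adj]
          by_cases h1 : s(y, z) = s(n, x)
          · right
            exact ⟨by simpa [Sym2.eq_iff, eq_comm, and_comm] using h1, hyz.ne⟩
          · left
            rw [Function.update_of_ne h1] at h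
            exact ⟨hyz, h⟩
        refine SimpleGraph.IsAcyclic.anti hle ?_
        rw [SimpleGraph.isAcyclic_sup_fromEdgeSet_iff]
        refine ⟨hc.2 e β, fun hr => Or.inl ?_⟩
        rcases hdis β hβ with h | h
        · refine (isolated_reach ?_ hr.symm).symm
          rintro y ⟨hy, h' | h'⟩
          · exact hex y hy h'
          · exact h y hy h'
        · refine isolated_reach ?_ hr
          rintro y ⟨hy, h' | h'⟩
          · exact hen y hy h'
          · exact h y hy h'
    intro α β
    by_cases hα : α = e
    · rw [hα]
      exact key β
    · by_cases hβ : β = e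
      · rw [hβ, B_swap]
        exact key α
      · refine SimpleGraph.IsAcyclic.anti ?_ (hc.2 α β)
        rintro y z ⟨hyz, h⟩
        refine ⟨hyz, ?_⟩
        by_cases h1 : s(y, z) = s(n, x)
        · rw [h1, Function.update_self] at h
          exact absurd h (by simp [Ne.symm hα, Ne.symm hβ])
        · rwa [Function.update_of_ne h1] at h

theorem step {V : Type*} [Finite V] {K H : SimpleGraph V} {v : V}
    (hdeg : ∀ x, (K.neighborSet x).ncard ≤ 4)
    (hHK : ∀ x y, H.Adj x y ↔ K.Adj x y ∧ x ≠ v ∧ y ≠ v) {c : Sym2 V → Fin 7} (hc : Good H c)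
    (g : V → Fin 4) (hg : ∀ u w, K.Adj v u → K.Adj v w → g u = g w → u = w)
    (T : Fin 4 → Finset (Fin 7)) (hT : ∀ k, (T k).card = 3)
    (hS : ∀ u, K.Adj v u → ∀ x, H.Adj u x → c s(u, x) ∈ T (g u)) :
    ∃ c', Good K c' := by
  classical
  rcases ext_or hHK hc g hg T hT hS with h | h
  · exact h
  obtain ⟨a, d, e, had, hdisj, hRR, hmiss, hcov⟩ := h
  simp only [decide_eq_true_eq, decide_eq_false_iff_not] at hdisj hRR hmiss hcov
  obtain ⟨i, hia⟩ : (T a).Nonempty := by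
    rw [← Finset.card_pos, hT]
    norm_num
  obtain ⟨j0, hj0⟩ : (T d).Nonempty := by
    rw [← Finset.card_pos, hT]
    norm_num
  have hid : i ∉ T d := fun h => hdisj i ⟨hia, h⟩
  -- the common neighbour
  have hsec : ∀ j ∈ T d, ∃ u, K.Adj v u ∧ g u = a ∧ ∃ x, H.Adj u x ∧ c s(u, x) = i ∧
      ∃ y, H.Adj x y ∧ c s(x, y) = j := by
    intro j hj
    obtain ⟨h1, h2, u, w, hu, hw, hne, hua, hwd, hr⟩ := hRR i j hia hj
    refine ⟨u, hu, hua, second_edge hc.1 hr hne ?_ ?_⟩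
    · intro x hx h
      apply h1
      rw [← hua, ← h]
      exact hS u hu x hx
    · intro x hx h
      apply h2
      rw [← hwd, ← h]
      exact hS w hw x hx
  obtain ⟨n, hvn, hna, x, hnx, hnxi, -⟩ := hsec j0 hj0
  have hxT : ∀ j ∈ T d, ∃ y, H.Adj x y ∧ c s(x, y) = j := by
    intro j hj
    obtain ⟨n', hvn', hna', x', hnx', hnxi', h⟩ := hsec j hj
    have h1 : n' = n := hg _ _ hvn' hvn (hna'.trans hna.symm)
    subst h1
    have h2 : x' = x := hc.1 _ _ _ hnx' hnx (hnxi'.trans hnxi.symm)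
    subst h2
    exact h
  have hxall : ∀ j ∈ insert i (T d), ∃ y, H.Adj x y ∧ c s(x, y) = j := by
    intro j hj
    rw [Finset.mem_insert] at hj
    rcases hj with rfl | hj
    · exact ⟨n, hnx.symm, by rw [Sym2.eq_swap]; exact hnxi⟩
    · exact hxT j hj
  have hcard4 : (insert i (T d)).card = 4 := by
    rw [Finset.card_insert_of_notMem hid, hT]
  have hxonly : ∀ y, H.Adj x y → c s(x, y) ∈ insert i (T d) := by
    intro y hy
    by_contra hcon
    have := color_card (hdeg x) c (insert (c s(x, y)) (insert i (T d))) (by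
      intro γ hγ
      rw [Finset.mem_insert] at hγ
      rcases hγ with rfl | hγ
      · exact ⟨y, ((hHK _ _).1 hy).1, rfl⟩
      · obtain ⟨y, hy, h⟩ := hxall γ hγ
        exact ⟨y, ((hHK _ _).1 hy).1, h⟩)
    rw [Finset.card_insert_of_notMem hcon, hcard4] at this
    omega
  have hxv : ¬ K.Adj v x := by
    intro h
    have hsub : insert i (T d) ⊆ T (g x) := by
      intro j hj
      obtain ⟨y, hy, rfl⟩ := hxall j hj
      exact hS x h y hy
    have := Finset.card_le_card hsub
    rw [hcard4, hT] at this
    omega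
  have hei : e ≠ i := by
    rintro rfl
    exact hmiss a hia
  have hna' : ∀ y, H.Adj n y → c s(n, y) ∈ T a := by
    intro y hy
    rw [← hna]
    exact hS n hvn y hy
  have hgood : Good H (Function.update c s(n, x) e) := by
    refine recolor_good hc hnx hnxi ?_ ?_ ?_
    · intro y hy h
      exact hmiss a (h ▸ hna' y hy)
    · intro y hy h
      have := hxonly y hy
      rw [h, Finset.mem_insert] at this
      exact this.elim hei (hmiss d)
    · intro β hβ
      by_cases hβd : β ∈ T d
      · right
        intro y hy h
        exact hdisj β ⟨h ▸ hna' y hy, hβd⟩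
      · left
        intro y hy h
        have := hxonly y hy
        rw [h, Finset.mem_insert] at this
        exact this.elim hβ hβd
  set T' : Fin 4 → Finset (Fin 7) := Function.update T a (insert e ((T a).erase i)) with hT'
  have hT'card : ∀ k, (T' k).card = 3 := by
    intro k
    by_cases hk : k = a
    · rw [hT', hk, Function.update_self, Finset.card_insert_of_notMem, Finset.card_erase_of_mem hia,
        hT]
      intro h
      exact hmiss a (Finset.mem_of_mem_erase h)
    · rw [hT', Function.update_of_ne hk, hT]
  have hS' : ∀ u, K.Adj v u → ∀ y, H.Adj u y →
      Function.update c s(n, x) e s(u, y) ∈ T' (g u) := by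
    intro u hu y hy
    by_cases hk : g u = a
    · have hun : u = n := hg _ _ hu hvn (hk.trans hna.symm)
      subst hun
      rw [hk, hT', Function.update_self, Finset.mem_insert, Finset.mem_erase]
      by_cases hyx : y = x
      · left
        rw [hyx, Function.update_self]
      · right
        have : s(u, y) ≠ s(u, x) := fun h => hyx (Sym2.congr_right.1 h)
        rw [Function.update_of_ne this]
        exact ⟨fun h => hyx (hc.1 _ _ _ hy hnx (h.trans hnxi.symm)), hna' y hy⟩
    · have hun : u ≠ n := by
        rintro rfl
        exact hk hna
      have hux : u ≠ x := by
        rintro rfl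
        exact hxv hu
      have : s(u, y) ≠ s(n, x) := by
        intro h
        rw [Sym2.eq_iff] at h
        rcases h with h | h
        · exact hun h.1
        · exact hux h.1
      rw [Function.update_of_ne this, hT', Function.update_of_ne hk]
      exact hS u hu y hy
  rcases ext_or hHK hgood g hg T' hT'card hS' with h | h
  · exact h
  exfalso
  obtain ⟨-, -, e', -, -, -, hmiss', -⟩ := h
  simp only [decide_eq_false_iff_not] at hmiss'
  by_cases hee : e' = e
  · apply hmiss' a
    rw [hT', Function.update_self, hee]
    exact Finset.mem_insert_self _ _
  · obtain ⟨u, hua, hu⟩ := hcov e' hee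
    apply hmiss' u
    rw [hT', Function.update_of_ne hua]
    exact hu

theorem step' {V : Type*} [Finite V] {K H : SimpleGraph V} {v : V}
    (hdeg : ∀ x, (K.neighborSet x).ncard ≤ 4)
    (hHK : ∀ x y, H.Adj x y ↔ K.Adj x y ∧ x ≠ v ∧ y ≠ v) {c : Sym2 V → Fin 7} (hc : Good H c) :
    ∃ c', Good K c' := by
  classical
  obtain ⟨g, hg⟩ : ∃ g : V → Fin 4, ∀ u w, K.Adj v u → K.Adj v w → g u = g w → u = w := by
    have hfin : (K.neighborSet v).Finite := Set.toFinite _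
    have hcd : hfin.toFinset.card ≤ Fintype.card (Fin 4) := by
      rw [← Set.ncard_eq_toFinset_card _ hfin]
      simpa using hdeg v
    have hcd' : Fintype.card hfin.toFinset ≤ Fintype.card (Fin 4) := by simpa using hcd
    obtain ⟨φ⟩ := Function.Embedding.nonempty_of_card_le hcd'
    refine ⟨fun u => if h : u ∈ hfin.toFinset then φ ⟨u, h⟩ else 0, ?_⟩
    intro u w hu hw h
    have hu' : u ∈ hfin.toFinset := by simpa using hu
    have hw' : w ∈ hfin.toFinset := by simpa using hw
    simp only [hu', hw', dif_pos] at h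
    exact congrArg Subtype.val (φ.injective h)
  have hex : ∀ k : Fin 4, ∃ t : Finset (Fin 7), t.card = 3 ∧
      ∀ u, K.Adj v u → g u = k → ∀ x, H.Adj u x → c s(u, x) ∈ t := by
    intro k
    by_cases h : ∃ u, K.Adj v u ∧ g u = k
    · obtain ⟨u, hu, huk⟩ := h
      have hHn : (H.neighborSet u).ncard ≤ 3 := by
        have h1 : insert v (H.neighborSet u) ⊆ K.neighborSet u := by
          intro y hy
          rcases hy with rfl | hy
          · exact hu.symm
          · exact ((hHK _ _).1 hy).1
        have h2 := Set.ncard_le_ncard h1 (Set.toFinite _)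
        have h4 : v ∉ H.neighborSet u := fun hy => ((hHK u v).1 hy).2.2 rfl
        rw [Set.ncard_insert_of_notMem h4 (Set.toFinite _)] at h2
        have := hdeg u
        omega
      have h3 := color_card hHn c (Finset.univ.filter fun γ => ∃ y, H.Adj u y ∧ c s(u, y) = γ)
        (by intro γ hγ; simpa using hγ)
      obtain ⟨t, ht1, -, ht3⟩ := Finset.exists_subsuperset_card_eq
        (Finset.subset_univ _) h3 (by simp)
      refine ⟨t, ht3, ?_⟩
      intro w hw hwk x hx
      have : w = u := hg _ _ hw hu (hwk.trans huk.symm)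
      subst this
      apply ht1
      simp only [Finset.mem_filter, Finset.mem_univ, true_and]
      exact ⟨x, hx, rfl⟩
    · exact ⟨{0, 1, 2}, by decide, fun u hu huk => absurd ⟨u, hu, huk⟩ h⟩
  choose T hT hS using hex
  exact step hdeg hHK hc g hg T hT (fun u hu x hx => hS _ u hu rfl x hx)

theorem exists_good {V : Type*} [Finite V] : ∀ (m : ℕ) (K : SimpleGraph V),
    K.edgeSet.ncard ≤ m → (∀ x, (K.neighborSet x).ncard ≤ 4) → ∃ c, Good K c := by
  intro m
  induction m with
  | zero =>
    intro K hm _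
    have h0 : K.edgeSet = ∅ := by
      rwa [Nat.le_zero, Set.ncard_eq_zero (Set.toFinite _)] at hm
    have hno : ∀ x y, ¬ K.Adj x y := by
      intro x y h
      have : s(x, y) ∈ K.edgeSet := h
      rw [h0] at this
      exact this
    refine ⟨fun _ => 0, fun u x y h => absurd h (hno _ _), fun α β => ?_⟩
    refine SimpleGraph.IsAcyclic.anti ?_ SimpleGraph.isAcyclic_bot
    intro x y h
    exact absurd h.1 (hno _ _)
  | succ m ih =>
    intro K hm hdeg
    by_cases hE : ∃ v w, K.Adj v w
    · obtain ⟨v, w, hvw⟩ := hE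
      let H : SimpleGraph V :=
        { Adj := fun x y => K.Adj x y ∧ x ≠ v ∧ y ≠ v
          symm := ⟨fun x y h => ⟨h.1.symm, h.2.2, h.2.1⟩⟩
          loopless := ⟨fun x h => K.loopless.irrefl x h.1⟩ }
      have hHK : ∀ x y, H.Adj x y ↔ K.Adj x y ∧ x ≠ v ∧ y ≠ v := fun x y => Iff.rfl
      have hle : H ≤ K := fun x y h => h.1
      have hlt : H.edgeSet.ncard < K.edgeSet.ncard := by
        apply Set.ncard_lt_ncard _ (Set.toFinite _)
        rw [SimpleGraph.edgeSet_ssubset_edgeSet]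
        refine lt_of_le_of_ne hle ?_
        intro h
        have : H.Adj v w := by rw [h]; exact hvw
        exact this.2.1 rfl
      obtain ⟨c, hc⟩ := ih H (by omega) (fun x => le_trans
        (Set.ncard_le_ncard (fun y hy => hle hy) (Set.toFinite _)) (hdeg x))
      exact step' hdeg hHK hc
    · apply ih K _ hdeg
      have h0 : K.edgeSet = ∅ := by
        ext e
        induction e with
        | h x y =>
          simp only [SimpleGraph.mem_edgeSet, Set.mem_empty_iff_false, iff_false]
          exact fun h => hE ⟨x, y, h⟩
      rw [h0]
      simp

end AEC

/-- **Corollary.** Every simple graph `G` with maximum degree at most 4 has an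
acyclic proper edge coloring using at most 7 colors, i.e. `a'(G) ≤ 7`. -/
theorem acyclic_edge_coloring_seven_colors {V : Type*} [Fintype V] [DecidableEq V]
    (G : SimpleGraph V) [DecidableRel G.Adj]
    (hΔ : G.maxDegree ≤ 4) :
    ∃ c : Sym2 V → ℕ, (∀ e ∈ G.edgeSet, c e < 7) ∧ AcyclicProperEdgeColoring G c := by
  have hdeg : ∀ x, (G.neighborSet x).ncard ≤ 4 := by
    intro x
    rw [← SimpleGraph.coe_neighborFinset, Set.ncard_coe_finset]
    exact (G.degree_le_maxDegree x).trans hΔ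
  obtain ⟨c, hc⟩ := AEC.exists_good _ G le_rfl hdeg
  refine ⟨fun e => (c e).val, fun e _ => (c e).isLt, ?_, ?_⟩
  · rintro e₁ h₁ e₂ h₂ hne ⟨v, hv₁, hv₂⟩ h
    obtain ⟨x, rfl⟩ := hv₁
    obtain ⟨y, rfl⟩ := hv₂
    apply hne
    rw [hc.1 v x y h₁ h₂ (Fin.ext h)]
  · rintro v p hp ⟨α, β, hαβ⟩
    have key : ∀ γ : ℕ, ∃ γ' : Fin 7, ∀ e : Sym2 V, (c e).val = γ → c e = γ' := by
      intro γ
      by_cases hγ : γ < 7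
      · exact ⟨⟨γ, hγ⟩, fun e h => Fin.ext h⟩
      · exact ⟨0, fun e h => absurd (h ▸ (c e).isLt) hγ⟩
    obtain ⟨α', hα'⟩ := key α
    obtain ⟨β', hβ'⟩ := key β
    have hmem : ∀ e ∈ p.edges, e ∈ (AEC.B G c α' β').edgeSet := by
      intro e he
      have h1 := p.edges_subset_edgeSet he
      have h2 := (hαβ e he).imp (hα' e) (hβ' e)
      induction e with
      | h x y => exact ⟨h1, h2⟩
    exact hc.2 α' β' (p.transfer _ hmem) (hp.transfer hmem)
end
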